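/- arXiv:1706.01866 — 6 statements merged into one kernel-verified Lean document; each statement's English description precedes it below -/
import Mathlib

section
/- For every η > 0 there exist ε > 0 and N such that for all n ≥ N and all integers k, t with 1/ε ≤ k ≤ ε·√n and 1/ε ≤ t ≤ ε·n²/k³, one has ζ(n,k,t) < exp(−(1−η)·t²k⁴/(4n²)). -/
/-- `zeta n k t` is the probability that `t` sets drawn uniformly and independently
from the `k`-element subsets of `{1,…,n}` form a packing (pairwise intersections of
size at most 1). -/
noncomputable def zeta (n k t : ℕ) : ℝ :=
  (Nat.card {A : Fin t → Finset (Fin n) //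
      (∀ i, (A i).card = k) ∧ ∀ i j, i ≠ j → ((A i) ∩ (A j)).card ≤ 1} : ℝ) /
    ((n.choose k : ℝ) ^ t)

open scoped Classical in
/-- The independent sets of `G` that extend `S` by exactly `r` vertices. -/
noncomputable def indepExtensions {V : Type*} [Fintype V] (G : SimpleGraph V) (S : Finset V)
    (r : ℕ) : Finset (Finset V) :=
  {T | S ⊆ T ∧ T.card = S.card + r ∧ G.IsIndepSet (T : Set V)}

theorem mem_indepExtensions {V : Type*} [Fintype V] (G : SimpleGraph V) {S T : Finset V} {r : ℕ} :
    T ∈ indepExtensions G S r ↔ S ⊆ T ∧ T.card = S.card + r ∧ G.IsIndepSet (T : Set V) := by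
  simp [indepExtensions]

section Independent

variable {V : Type*} [Fintype V] [DecidableEq V] (G : SimpleGraph V) [DecidableRel G.Adj]

/-- The vertices with a neighbour in `S`. -/
def neighborUnion (S : Finset V) : Finset V := S.biUnion fun v => G.neighborFinset v

theorem succ_mul_card_indepExtensions_le (S : Finset V) (r : ℕ) :
    (r + 1) * (indepExtensions G S (r + 1)).card ≤
      ∑ a ∈ (S ∪ neighborUnion G S)ᶜ, (indepExtensions G (insert a S) r).card := by
  have h := Finset.sum_card_bipartiteAbove_eq_sum_card_bipartiteBelow
    (s := indepExtensions G S (r + 1)) (t := (S ∪ neighborUnion G S)ᶜ) (fun T a => a ∈ T)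
  calc (r + 1) * (indepExtensions G S (r + 1)).card
      = ∑ T ∈ indepExtensions G S (r + 1), (r + 1) := by simp [mul_comm]
    _ ≤ ∑ T ∈ indepExtensions G S (r + 1),
          (Finset.bipartiteAbove (fun T a => a ∈ T) (S ∪ neighborUnion G S)ᶜ T).card := by
        refine Finset.sum_le_sum fun T hT => ?_
        obtain ⟨hST, hc, hi⟩ := (mem_indepExtensions G).1 hT
        have : (T \ S).card = r + 1 := by
          rw [Finset.card_sdiff_of_subset hST, hc]; omega
        rw [← this]
        refine Finset.card_le_card fun a ha => ?_
        rw [Finset.mem_sdiff] at ha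
        simp only [Finset.bipartiteAbove, Finset.mem_filter, Finset.mem_compl, Finset.mem_union,
          neighborUnion, Finset.mem_biUnion, SimpleGraph.mem_neighborFinset, not_or, not_exists,
          not_and]
        refine ⟨⟨ha.2, fun u hu hadj => ?_⟩, ha.1⟩
        exact hi (by simpa using hST hu) (by simpa using ha.1) hadj.ne hadj
    _ = _ := h
    _ ≤ _ := by
        refine Finset.sum_le_sum fun a ha => Finset.card_le_card fun T hT => ?_
        simp only [Finset.bipartiteBelow, Finset.mem_filter] at hT
        obtain ⟨hST, hc, hi⟩ := (mem_indepExtensions G).1 hT.1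
        have haS : a ∉ S := fun h' => by simp [h'] at ha
        refine (mem_indepExtensions G).2 ⟨Finset.insert_subset hT.2 hST, ?_, hi⟩
        rw [Finset.card_insert_of_notMem haS, hc]; omega

theorem sum_card_neighborFinset_inter (U : Finset V) :
    ∑ a, (G.neighborFinset a ∩ U).card = ∑ x ∈ U, G.degree x := by
  have h := Finset.sum_card_bipartiteAbove_eq_sum_card_bipartiteBelow
    (s := (Finset.univ : Finset V)) (t := U) (fun a x => G.Adj a x)
  convert h using 2 with a _ x hx
  · congr 1; ext x; simp [Finset.bipartiteAbove, and_comm]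
  · rw [← SimpleGraph.card_neighborFinset_eq_degree]
    congr 1; ext a; simp [Finset.bipartiteBelow, G.adj_comm]

theorem sum_degree_le_sum_card_sdiff {D : ℝ} (hD : ∀ v, (G.degree v : ℝ) ≤ D)
    {S : Finset V} :
    (∑ v, (G.degree v : ℝ)) - 2 * D * (neighborUnion G S).card ≤
      ∑ a ∈ (S ∪ neighborUnion G S)ᶜ, ((G.neighborFinset a \ neighborUnion G S).card : ℝ) := by
  set U := neighborUnion G S with hU
  have hdeg : ∑ x ∈ U, (G.degree x : ℝ) ≤ D * U.card := by
    calc _ ≤ ∑ x ∈ U, D := Finset.sum_le_sum fun x _ => hD x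
      _ = _ := by simp [mul_comm]
  have hinter : ∑ a, ((G.neighborFinset a ∩ U).card : ℝ) = ∑ x ∈ U, (G.degree x : ℝ) := by
    exact_mod_cast sum_card_neighborFinset_inter G U
  have hall : ∑ a, ((G.neighborFinset a \ U).card : ℝ) =
      (∑ v, (G.degree v : ℝ)) - ∑ x ∈ U, (G.degree x : ℝ) := by
    rw [← hinter, ← Finset.sum_sub_distrib]
    refine Finset.sum_congr rfl fun a _ => ?_
    rw [← SimpleGraph.card_neighborFinset_eq_degree, eq_sub_iff_add_eq]
    exact_mod_cast Finset.card_sdiff_add_card_inter _ _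
  have hsplit : ∑ a, ((G.neighborFinset a \ U).card : ℝ) =
      ∑ a ∈ (S ∪ U), ((G.neighborFinset a \ U).card : ℝ) +
        ∑ a ∈ (S ∪ U)ᶜ, ((G.neighborFinset a \ U).card : ℝ) :=
    (Finset.sum_add_sum_compl _ _).symm
  have hSU : ∑ a ∈ (S ∪ U), ((G.neighborFinset a \ U).card : ℝ) ≤
      ∑ x ∈ U, (G.degree x : ℝ) := by
    rw [← Finset.sum_subset (Finset.subset_union_right : U ⊆ S ∪ U)]
    · refine Finset.sum_le_sum fun a _ => ?_
      rw [← SimpleGraph.card_neighborFinset_eq_degree]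
      exact_mod_cast Finset.card_le_card Finset.sdiff_subset
    · intro a ha haU
      have haS : a ∈ S := by simpa [haU] using ha
      have : G.neighborFinset a \ U = ∅ := by
        rw [Finset.sdiff_eq_empty_iff_subset]
        exact Finset.subset_biUnion_of_mem (fun v => G.neighborFinset v) haS
      simp [this]
  linarith

theorem exp_neg_le_one_sub_mul {x δ : ℝ} (hx : 0 ≤ x) (hxδ : x ≤ δ) :
    Real.exp (-x) ≤ 1 - (1 - δ) * x := by
  have h1 : 1 + x ≤ Real.exp x := by linarith [Real.add_one_le_exp x]
  have h2 : Real.exp (-x) ≤ 1 / (1 + x) := by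
    rw [Real.exp_neg, ← one_div]
    exact one_div_le_one_div_of_le (by linarith) h1
  refine h2.trans ?_
  rw [div_le_iff₀ (by linarith)]
  nlinarith [mul_nonneg hx (sub_nonneg.2 hxδ), mul_nonneg (mul_nonneg hx hx) (hx.trans hxδ)]

theorem card_indepExtensions_le {D δ : ℝ} (hδ : 0 ≤ δ) (hδ2 : δ ≤ 1 / 2)
    (hD : ∀ v, (G.degree v : ℝ) ≤ D) (r : ℕ) :
    ∀ S : Finset V, G.IsIndepSet (S : Set V) → r * D ≤ δ * Fintype.card V →
      ((indepExtensions G S r).card : ℝ) ≤ ((Fintype.card V - S.card).choose r : ℝ) *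
        Real.exp (-((1 - 2 * δ) * r * (neighborUnion G S).card / Fintype.card V +
          (1 - δ) * (1 - 2 * δ) * (r.choose 2) * (∑ v, (G.degree v : ℝ)) /
            (Fintype.card V : ℝ) ^ 2)) := by
  induction r with
  | zero =>
    intro S hS _
    have : indepExtensions G S 0 ⊆ {S} := by
      intro T hT
      obtain ⟨hST, hc, hi⟩ := (mem_indepExtensions G).1 hT
      rw [Finset.mem_singleton]
      exact (Finset.eq_of_subset_of_card_le hST (by omega)).symm
    simpa using Finset.card_le_card this
  | succ r ih =>
    intro S hS hr
    set n := Fintype.card V with hn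
    set U := neighborUnion G S with hU
    set E : ℝ := ∑ v, (G.degree v : ℝ) with hE
    have hE0 : 0 ≤ E := Finset.sum_nonneg fun _ _ => Nat.cast_nonneg _
    have hrec := succ_mul_card_indepExtensions_le G S r
    rcases Nat.eq_zero_or_pos n with hn0 | hnpos
    · have hemp : (Finset.univ : Finset V) = ∅ := Finset.card_eq_zero.1 hn0
      have : (S ∪ neighborUnion G S)ᶜ = ∅ := Finset.subset_empty.1 (hemp ▸ Finset.subset_univ _)
      rw [this, Finset.sum_empty] at hrec
      have : (indepExtensions G S (r + 1)).card = 0 := by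
        by_contra h
        have := Nat.mul_pos r.succ_pos (Nat.pos_of_ne_zero h)
        simp only [Nat.succ_eq_add_one] at this
        omega
      rw [this, Nat.cast_zero]
      positivity
    have hnR : (0 : ℝ) < n := by exact_mod_cast hnpos
    have hv : Nonempty V := Fintype.card_pos_iff.1 hnpos
    have hD0 : 0 ≤ D := (Nat.cast_nonneg _).trans (hD hv.some)
    have hr' : r * D ≤ δ * n := by push_cast at hr; nlinarith
    have hSn : S.card ≤ n := Finset.card_le_univ S
    have hdisj : Disjoint S U := by
      rw [Finset.disjoint_left]
      intro a haS haU
      obtain ⟨u, hu, hua⟩ := Finset.mem_biUnion.1 haU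
      have hadj : G.Adj u a := by simpa using hua
      exact hS (by simpa using hu) (by simpa using haS) hadj.ne hadj
    have hcompl : (((S ∪ U)ᶜ).card : ℝ) = n - S.card - U.card := by
      have h1 := Finset.card_compl_add_card (S ∪ U)
      rw [Finset.card_union_of_disjoint hdisj] at h1
      have : (((S ∪ U)ᶜ).card : ℝ) + (S.card + U.card) = n := by exact_mod_cast h1
      linarith
    set Q : ℝ := (1 - δ) * (1 - 2 * δ) * (r.choose 2) * E / (n : ℝ) ^ 2 with hQ
    set B : ℝ := (((n - S.card) - 1).choose r : ℝ) *
      Real.exp (-((1 - 2 * δ) * r * U.card / n + Q)) with hB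
    have hstep : ∀ a ∈ (S ∪ U)ᶜ, ((indepExtensions G (insert a S) r).card : ℝ) ≤
        B * (1 - (1 - δ) * ((1 - 2 * δ) * r * (G.neighborFinset a \ U).card / n)) := by
      intro a ha
      simp only [Finset.mem_compl, Finset.mem_union, not_or] at ha
      have haU : ∀ u ∈ S, ¬ G.Adj u a := fun u hu hadj =>
        ha.2 (Finset.mem_biUnion.2 ⟨u, hu, by simpa using hadj⟩)
      have hind : G.IsIndepSet ((insert a S : Finset V) : Set V) := by
        rw [Finset.coe_insert, SimpleGraph.isIndepSet_iff, Set.pairwise_insert]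
        refine ⟨hS, fun b hb _ => ⟨fun h => haU b hb h.symm, haU b hb⟩⟩
      have hcard : ((neighborUnion G (insert a S)).card : ℝ) =
          U.card + (G.neighborFinset a \ U).card := by
        have : neighborUnion G (insert a S) = U ∪ (G.neighborFinset a \ U) := by
          rw [neighborUnion, Finset.biUnion_insert, Finset.union_sdiff_self_eq_union,
            Finset.union_comm, hU, neighborUnion]
        rw [this, Finset.card_union_of_disjoint Finset.disjoint_sdiff]
        push_cast; rfl
      have hgD : ((G.neighborFinset a \ U).card : ℝ) ≤ D := by
        refine le_trans ?_ (hD a)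
        rw [← SimpleGraph.card_neighborFinset_eq_degree]
        exact_mod_cast Finset.card_le_card Finset.sdiff_subset
      have hx0 : 0 ≤ (1 - 2 * δ) * r * (G.neighborFinset a \ U).card / n := by
        have : 0 ≤ 1 - 2 * δ := by linarith
        positivity
      have hxδ : (1 - 2 * δ) * r * (G.neighborFinset a \ U).card / n ≤ δ := by
        rw [div_le_iff₀ hnR]
        have h1 : (r : ℝ) * (G.neighborFinset a \ U).card ≤ r * D := by gcongr
        have h2 : (0 : ℝ) ≤ r * (G.neighborFinset a \ U).card := by positivity
        nlinarith [mul_nonneg hδ h2]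
      refine (ih (insert a S) hind hr').trans ?_
      rw [Finset.card_insert_of_notMem ha.1, hcard, Nat.sub_add_eq, hB]
      refine (mul_le_mul_of_nonneg_left ?_ (Nat.cast_nonneg _)).trans_eq (mul_assoc _ _ _).symm
      calc _ = Real.exp (-((1 - 2 * δ) * r * U.card / n + Q)) *
            Real.exp (-((1 - 2 * δ) * r * (G.neighborFinset a \ U).card / n)) := by
            rw [← Real.exp_add]; congr 1; ring
        _ ≤ _ := by
            gcongr
            exact exp_neg_le_one_sub_mul hx0 hxδ
    have hB0 : 0 ≤ B := by positivity
    have hsum := sum_degree_le_sum_card_sdiff G hD (S := S)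
    rw [← hU, ← hE] at hsum
    set W : ℝ := ∑ a ∈ (S ∪ U)ᶜ, ((G.neighborFinset a \ U).card : ℝ) with hW
    set X : ℝ := (1 - 2 * δ) * U.card / n + (1 - δ) * (1 - 2 * δ) * r * E / (n : ℝ) ^ 2 with hX
    have hX0 : 0 ≤ X := by
      have : 0 ≤ 1 - 2 * δ := by linarith
      have : 0 ≤ 1 - δ := by linarith
      positivity
    have hnX : n * X = (1 - 2 * δ) * U.card + (1 - δ) * (1 - 2 * δ) * r / n * E := by
      rw [hX]; field_simp
    have hmain : ∑ a ∈ (S ∪ U)ᶜ,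
        (1 - (1 - δ) * ((1 - 2 * δ) * r * (G.neighborFinset a \ U).card / n)) ≤
        ((n - S.card : ℕ) : ℝ) * Real.exp (-X) := by
      have hcoef : 0 ≤ (1 - δ) * (1 - 2 * δ) * r / n := by
        have : 0 ≤ 1 - 2 * δ := by linarith
        have : 0 ≤ 1 - δ := by linarith
        positivity
      have hcoefD : (1 - δ) * (1 - 2 * δ) * r / n * D ≤ δ := by
        rw [div_mul_eq_mul_div, div_le_iff₀ hnR]
        have h2 : (0 : ℝ) ≤ r * D := by positivity
        have h3 : (1 - δ) * (1 - 2 * δ) ≤ 1 := by nlinarith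
        nlinarith [mul_le_mul_of_nonneg_right h3 h2]
      calc _ = (n - S.card - U.card) - (1 - δ) * (1 - 2 * δ) * r / n * W := by
            rw [Finset.sum_sub_distrib, Finset.sum_const, nsmul_eq_mul, hcompl, hW,
              Finset.mul_sum]
            congr 1
            · ring
            · exact Finset.sum_congr rfl fun _ _ => by ring
        _ ≤ (n - S.card - U.card) - (1 - δ) * (1 - 2 * δ) * r / n * (E - 2 * D * U.card) := by
            gcongr
        _ ≤ (n - S.card) - n * X := by
            have : (0 : ℝ) ≤ U.card := Nat.cast_nonneg _
            rw [hnX]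
            nlinarith [mul_le_mul_of_nonneg_right hcoefD this]
        _ ≤ (n - S.card) * (1 - X) := by
            have : (0 : ℝ) ≤ S.card := Nat.cast_nonneg _
            nlinarith
        _ ≤ _ := by
            rw [Nat.cast_sub hSn]
            have : (S.card : ℝ) ≤ n := by exact_mod_cast hSn
            have := Real.add_one_le_exp (-X)
            gcongr
            · linarith
    have hrec' : ((r : ℝ) + 1) * (indepExtensions G S (r + 1)).card ≤
        ∑ a ∈ (S ∪ U)ᶜ, ((indepExtensions G (insert a S) r).card : ℝ) := by
      exact_mod_cast hrec
    have hchoose : ((n - S.card : ℕ) : ℝ) * (((n - S.card) - 1).choose r) =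
        (r + 1) * ((n - S.card).choose (r + 1)) := by
      rcases Nat.eq_zero_or_pos (n - S.card) with h0 | hp
      · simp [h0]
      · obtain ⟨j, hj⟩ := Nat.exists_eq_succ_of_ne_zero hp.ne'
        rw [hj]
        have := Nat.add_one_mul_choose_eq j r
        simp only [Nat.succ_eq_add_one, Nat.add_sub_cancel]
        rw [mul_comm ((r : ℝ) + 1)]
        exact_mod_cast this
    have hfin : ((r : ℝ) + 1) * (indepExtensions G S (r + 1)).card ≤
        ((r : ℝ) + 1) * (((n - S.card).choose (r + 1)) *
          Real.exp (-((1 - 2 * δ) * r * U.card / n + Q) + -X)) := by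
      calc _ ≤ _ := hrec'
        _ ≤ _ := Finset.sum_le_sum hstep
        _ = B * _ := (Finset.mul_sum _ _ _).symm
        _ ≤ B * _ := mul_le_mul_of_nonneg_left hmain hB0
        _ = ((n - S.card : ℕ) * (((n - S.card) - 1).choose r)) *
              (Real.exp (-((1 - 2 * δ) * r * U.card / n + Q)) * Real.exp (-X)) := by
            rw [hB]; ring
        _ = _ := by rw [hchoose, ← Real.exp_add]; ring
    refine (le_of_mul_le_mul_left hfin (by positivity)).trans (le_of_eq ?_)
    congr 2
    rw [hX, hQ, Nat.choose_succ_succ' r 1]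
    push_cast
    simp only [Nat.choose_one_right]
    ring

/-- A graph of maximum degree at most `δn/k` has few independent `k`-sets. -/
theorem card_indepSets_le {D δ : ℝ} (hδ : 0 ≤ δ) (hδ2 : δ ≤ 1 / 2)
    (hD : ∀ v, (G.degree v : ℝ) ≤ D) (k : ℕ) (hk : k * D ≤ δ * Fintype.card V) :
    ((indepExtensions G ∅ k).card : ℝ) ≤ ((Fintype.card V).choose k : ℝ) *
      Real.exp (-((1 - δ) * (1 - 2 * δ) * (k.choose 2) * (∑ v, (G.degree v : ℝ)) /
        (Fintype.card V : ℝ) ^ 2)) := by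
  simpa [neighborUnion] using card_indepExtensions_le G hδ hδ2 hD k ∅ (by simp) hk

end Independent

theorem choose_mul_pow_le {h n : ℕ} (hn : h ≤ n) (s : ℕ) :
    h.choose s * n ^ s ≤ n.choose s * h ^ s := by
  induction s with
  | zero => simp
  | succ s ih =>
    rcases Nat.lt_or_ge h (s + 1) with hs | hs
    · simp [Nat.choose_eq_zero_of_lt hs]
    · have h1 := Nat.choose_succ_right_eq h s
      have h2 := Nat.choose_succ_right_eq n s
      have h3 : (h - s) * n ≤ (n - s) * h := by
        obtain ⟨a, rfl⟩ := Nat.exists_eq_add_of_le (show s ≤ h by omega)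
        obtain ⟨b, rfl⟩ := Nat.exists_eq_add_of_le hn
        rw [show s + a - s = a by omega, show s + a + b - s = a + b by omega]
        nlinarith [Nat.zero_le (s * b)]
      refine Nat.le_of_mul_le_mul_right ?_ s.succ_pos
      calc h.choose (s + 1) * n ^ (s + 1) * (s + 1)
          = (h.choose (s + 1) * (s + 1)) * n ^ (s + 1) := by ring
        _ = (h.choose s * n ^ s) * ((h - s) * n) := by rw [h1]; ring
        _ ≤ (n.choose s * h ^ s) * ((n - s) * h) := Nat.mul_le_mul ih h3
        _ = (n.choose s * (n - s)) * h ^ (s + 1) := by ring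
        _ = n.choose (s + 1) * h ^ (s + 1) * (s + 1) := by rw [← h2]; ring

/-- The graph `G` with all edges inside `L` added. -/
def addClique {V : Type*} (G : SimpleGraph V) (L : Finset V) : SimpleGraph V where
  Adj u v := G.Adj u v ∨ u ≠ v ∧ u ∈ L ∧ v ∈ L
  symm := ⟨fun _ _ h => h.imp (fun h => h.symm) fun h => ⟨h.1.symm, h.2.2, h.2.1⟩⟩
  loopless := ⟨fun _ h => h.elim (fun h => G.irrefl h) fun h => h.1 rfl⟩

theorem addClique_adj {V : Type*} (G : SimpleGraph V) (L : Finset V) (u v : V) :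
    (addClique G L).Adj u v ↔ G.Adj u v ∨ u ≠ v ∧ u ∈ L ∧ v ∈ L :=
  Iff.rfl

theorem addClique_empty {V : Type*} (G : SimpleGraph V) : addClique G ∅ = G := by
  ext u v
  simp [addClique_adj]

theorem isIndepSet_addClique {V : Type*} [DecidableEq V] {G : SimpleGraph V}
    {A B L : Finset V} (hLA : L ⊆ A)
    (hB : G.IsIndepSet (B : Set V)) (hAB : (A ∩ B).card ≤ 1) :
    (addClique G L).IsIndepSet (B : Set V) := by
  intro u hu v hv huv hadj
  rcases hadj with h | ⟨-, huL, hvL⟩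
  · exact hB hu hv huv h
  · exact huv (Finset.card_le_one.1 hAB u (Finset.mem_inter.2 ⟨hLA huL, hu⟩) v
      (Finset.mem_inter.2 ⟨hLA hvL, hv⟩))

theorem card_high_degree_mul_le {V : Type*} [Fintype V] (G : SimpleGraph V)
    [DecidableRel G.Adj] (c : ℝ) :
    (({v | c < G.degree v} : Finset V).card : ℝ) * c ≤ ∑ v, (G.degree v : ℝ) := by
  calc _ = ∑ v ∈ ({v | c < G.degree v} : Finset V), c := by simp
    _ ≤ ∑ v ∈ ({v | c < G.degree v} : Finset V), (G.degree v : ℝ) :=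
        Finset.sum_le_sum fun v hv => (Finset.mem_filter.1 hv).2.le
    _ ≤ _ := Finset.sum_le_sum_of_subset_of_nonneg (Finset.subset_univ _)
        fun _ _ _ => Nat.cast_nonneg _

section Packing

variable {V : Type*} [Fintype V] [DecidableEq V]

theorem card_powersetCard_inter_le (H : Finset V) (k s : ℕ) :
    ({A ∈ Finset.powersetCard k Finset.univ | s ≤ (A ∩ H).card} : Finset (Finset V)).card ≤
      H.card.choose s * (Fintype.card V - s).choose (k - s) := by
  calc _ ≤ ((Finset.powersetCard s H).biUnion fun S =>
        {A ∈ Finset.powersetCard k (Finset.univ : Finset V) | S ⊆ A}).card := by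
        refine Finset.card_le_card fun A hA => ?_
        rw [Finset.mem_filter] at hA
        obtain ⟨S, hS, hSc⟩ := Finset.exists_subset_card_eq hA.2
        rw [Finset.mem_biUnion]
        exact ⟨S, Finset.mem_powersetCard.2 ⟨hS.trans Finset.inter_subset_right, hSc⟩,
          Finset.mem_filter.2 ⟨hA.1, hS.trans Finset.inter_subset_left⟩⟩
    _ ≤ (Finset.powersetCard s H).card * (Fintype.card V - s).choose (k - s) := by
        refine Finset.card_biUnion_le_card_mul _ _ _ fun S hS => ?_
        obtain ⟨-, hSc⟩ := Finset.mem_powersetCard.1 hS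
        have hc : (Finset.powersetCard (k - s) Sᶜ).card =
            (Fintype.card V - s).choose (k - s) := by
          rw [Finset.card_powersetCard, Finset.card_compl, hSc]
        rw [← hc]
        refine Finset.card_le_card_of_injOn (fun A => A \ S) ?_ ?_
        · intro A hA
          simp only [Finset.coe_filter, Finset.mem_powersetCard, Set.mem_ofPred_eq] at hA
          simp only [Finset.mem_coe, Finset.mem_powersetCard]
          refine ⟨fun x hx => by simpa using (Finset.mem_sdiff.1 hx).2, ?_⟩
          rw [Finset.card_sdiff_of_subset hA.2, hA.1.2, hSc]
        · intro A hA B hB hAB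
          simp only [Finset.coe_filter, Finset.mem_powersetCard, Set.mem_ofPred_eq] at hA hB
          rw [← Finset.sdiff_union_of_subset hA.2, ← Finset.sdiff_union_of_subset hB.2]
          exact congrArg (· ∪ S) hAB
    _ = _ := by rw [Finset.card_powersetCard]

theorem card_powersetCard_inter_le_mul_pow [Nonempty V] (H : Finset V) (k s : ℕ) :
    (({A ∈ Finset.powersetCard k Finset.univ | s ≤ (A ∩ H).card} :
      Finset (Finset V)).card : ℝ) ≤
      (Fintype.card V).choose k * (2 ^ k * ((H.card : ℝ) / Fintype.card V) ^ s) := by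
  set n := Fintype.card V with hn
  have hnpos : (0 : ℝ) < n := by exact_mod_cast Fintype.card_pos
  set c := ({A ∈ Finset.powersetCard k Finset.univ | s ≤ (A ∩ H).card} :
      Finset (Finset V)).card with hc
  rcases Nat.eq_zero_or_pos c with h0 | hpos
  · rw [h0, Nat.cast_zero]; positivity
  obtain ⟨A, hA⟩ := Finset.card_pos.1 hpos
  rw [Finset.mem_filter, Finset.mem_powersetCard] at hA
  have hsk : s ≤ k := hA.1.2 ▸ hA.2.trans (Finset.card_le_card Finset.inter_subset_left)
  have hkn : k ≤ n := hA.1.2 ▸ Finset.card_le_univ A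
  have hcle : c ≤ H.card.choose s * (n - s).choose (k - s) := card_powersetCard_inter_le H k s
  have key : c * n ^ s ≤ n.choose k * (2 ^ k * H.card ^ s) := by
    calc c * n ^ s ≤ H.card.choose s * (n - s).choose (k - s) * n ^ s := by gcongr
      _ = (H.card.choose s * n ^ s) * (n - s).choose (k - s) := by ring
      _ ≤ (n.choose s * H.card ^ s) * (n - s).choose (k - s) :=
          Nat.mul_le_mul_right _ (choose_mul_pow_le (Finset.card_le_univ H) s)
      _ = (n.choose s * (n - s).choose (k - s)) * H.card ^ s := by ring
      _ = (n.choose k * k.choose s) * H.card ^ s := by rw [Nat.choose_mul hsk]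
      _ ≤ (n.choose k * 2 ^ k) * H.card ^ s := by
          gcongr
          exact Nat.choose_le_two_pow k s
      _ = _ := by ring
  have key' : (c : ℝ) * n ^ s ≤ n.choose k * (2 ^ k * (H.card : ℝ) ^ s) := by exact_mod_cast key
  rw [div_pow, ← mul_div_assoc, ← mul_div_assoc, le_div_iff₀ (by positivity)]
  exact key'

theorem degree_addClique (G : SimpleGraph V) [DecidableRel G.Adj] (L : Finset V)
    [DecidableRel (addClique G L).Adj] (hL : G.IsIndepSet (L : Set V)) (v : V) :
    (addClique G L).degree v = G.degree v + if v ∈ L then L.card - 1 else 0 := by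
  rw [← SimpleGraph.card_neighborFinset_eq_degree, ← SimpleGraph.card_neighborFinset_eq_degree]
  split_ifs with hv
  · rw [← Finset.card_erase_of_mem hv, ← Finset.card_union_of_disjoint]
    · congr 1
      ext u
      simp only [SimpleGraph.mem_neighborFinset, addClique_adj, Finset.mem_union, Finset.mem_erase]
      grind
    · rw [Finset.disjoint_left]
      intro u hu huL
      rw [SimpleGraph.mem_neighborFinset] at hu
      exact hL (by simpa using hv) (by simpa using Finset.mem_of_mem_erase huL) hu.ne hu
  · rw [add_zero]
    congr 1
    ext u
    simp only [SimpleGraph.mem_neighborFinset, addClique_adj]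
    grind

theorem sum_degree_addClique (G : SimpleGraph V) [DecidableRel G.Adj] (L : Finset V)
    [DecidableRel (addClique G L).Adj] (hL : G.IsIndepSet (L : Set V)) :
    ∑ v, (addClique G L).degree v = ∑ v, G.degree v + L.card * (L.card - 1) := by
  simp [degree_addClique G L hL, Finset.sum_add_distrib]

open scoped Classical in
/-- The `r`-tuples of `k`-sets that form a packing of independent sets of `G`. -/
noncomputable def packings (G : SimpleGraph V) (k r : ℕ) : Finset (Fin r → Finset V) :=
  {B | (∀ i, (B i).card = k ∧ G.IsIndepSet (B i : Set V)) ∧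
    ∀ i j, i ≠ j → (B i ∩ B j).card ≤ 1}

theorem mem_packings {G : SimpleGraph V} {k r : ℕ} {B : Fin r → Finset V} :
    B ∈ packings G k r ↔ (∀ i, (B i).card = k ∧ G.IsIndepSet (B i : Set V)) ∧
      ∀ i j, i ≠ j → (B i ∩ B j).card ≤ 1 := by
  simp [packings]

theorem card_packings_head_le {G : SimpleGraph V} (k r : ℕ) {A L : Finset V} (hLA : L ⊆ A) :
    ({B ∈ packings G k (r + 1) | B 0 = A} : Finset (Fin (r + 1) → Finset V)).card ≤
      (packings (addClique G L) k r).card := by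
  refine Finset.card_le_card_of_injOn (fun B => Fin.tail B) ?_ ?_
  · intro B hB
    simp only [Finset.coe_filter, Set.mem_ofPred_eq, mem_packings] at hB
    obtain ⟨⟨h1, h2⟩, rfl⟩ := hB
    rw [Finset.mem_coe, mem_packings]
    exact ⟨fun i => ⟨(h1 i.succ).1, isIndepSet_addClique hLA (h1 i.succ).2
      (h2 0 i.succ (Fin.succ_ne_zero i).symm)⟩,
      fun i j hij => h2 i.succ j.succ fun h => hij (Fin.succ_injective _ h)⟩
  · intro B hB C hC hBC
    simp only [Finset.coe_filter, Set.mem_ofPred_eq] at hB hC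
    rw [← Fin.cons_self_tail B, ← Fin.cons_self_tail C, hB.2, hC.2]
    exact congrArg _ hBC

theorem card_packings_le {δ D p y : ℝ} {k q T : ℕ} (hδ : 0 ≤ δ) (hδ2 : δ ≤ 1 / 2)
    (hkD : k * D ≤ δ * Fintype.card V) (hp : 0 ≤ p)
    (hy : y = (1 - δ) * (1 - 2 * δ) * (k.choose 2) * ((k - q) * (k - q - 1) : ℕ) /
      (Fintype.card V : ℝ) ^ 2)
    (hbad : ∀ H : Finset V, H.card * (D - k) ≤ T * (k : ℝ) ^ 2 →
      (({A ∈ Finset.powersetCard k Finset.univ | q + 1 ≤ (A ∩ H).card} :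
        Finset (Finset V)).card : ℝ) ≤ (Fintype.card V).choose k * p)
    (r : ℕ) : ∀ (g : ℕ) (G : SimpleGraph V) [DecidableRel G.Adj], g + r ≤ T →
      (∀ v, (G.degree v : ℝ) ≤ D) →
      g * ((k - q) * (k - q - 1)) ≤ ∑ v, G.degree v →
      ∑ v, G.degree v ≤ g * k ^ 2 →
      ((packings G k r).card : ℝ) ≤ ((Fintype.card V).choose k : ℝ) ^ r *
        (Real.exp (-(y * (g * r + r.choose 2))) * (1 + p * Real.exp (y * T)) ^ r) := by
  have hy0 : 0 ≤ y := by
    have : 0 ≤ 1 - 2 * δ := by linarith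
    have : 0 ≤ 1 - δ := by linarith
    rw [hy]; positivity
  induction r with
  | zero =>
    intro g G _ _ _ _ _
    have : (packings G k 0).card ≤ 1 := (Finset.card_le_univ _).trans (by simp)
    simpa using this
  | succ r ih =>
    intro g G _ hgT hdeg hlow hup
    classical
    set N : ℝ := ((Fintype.card V).choose k : ℝ) with hN
    set P : ℝ := 1 + p * Real.exp (y * T) with hP
    set H : Finset V := {v | D - k < G.degree v} with hH
    have hP0 : 0 ≤ P := by positivity
    have hHcard : H.card * (D - k) ≤ T * (k : ℝ) ^ 2 := by
      refine (card_high_degree_mul_le G (D - k)).trans ?_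
      have h1 : ∑ v, (G.degree v : ℝ) ≤ g * (k : ℝ) ^ 2 := by exact_mod_cast hup
      have h2 : (g : ℝ) ≤ T := by exact_mod_cast (show g ≤ T by omega)
      nlinarith [sq_nonneg (k : ℝ)]
    set I := indepExtensions G ∅ k with hI
    have hsum : (packings G k (r + 1)).card = ∑ A ∈ I,
        ({B ∈ packings G k (r + 1) | B 0 = A} : Finset (Fin (r + 1) → Finset V)).card := by
      refine Finset.card_eq_sum_card_fiberwise fun B hB => ?_
      have := (mem_packings.1 hB).1 0
      simpa [hI, mem_indepExtensions] using this
    have hgood : ∀ A ∈ {A ∈ I | ¬ q + 1 ≤ (A ∩ H).card},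
        (({B ∈ packings G k (r + 1) | B 0 = A} :
          Finset (Fin (r + 1) → Finset V)).card : ℝ) ≤
        N ^ r * (Real.exp (-(y * ((g + 1 : ℕ) * r + r.choose 2))) * P ^ r) := by
      intro A hA
      obtain ⟨hAI, hAq⟩ := Finset.mem_filter.1 hA
      obtain ⟨-, hAc, hAi⟩ := (mem_indepExtensions G).1 hAI
      have hAc : A.card = k := by simpa using hAc
      have hLA : A \ H ⊆ A := Finset.sdiff_subset
      have hLi : G.IsIndepSet ((A \ H : Finset V) : Set V) :=
        Set.Pairwise.mono (by exact_mod_cast hLA) hAi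
      have hLk : (A \ H).card ≤ k := hAc ▸ Finset.card_le_card hLA
      have hLq : k - q ≤ (A \ H).card := by
        have := Finset.card_sdiff_add_card_inter A H
        omega
      have hprod : (k - q) * (k - q - 1) ≤ (A \ H).card * ((A \ H).card - 1) :=
        Nat.mul_le_mul hLq (by omega)
      have hprod' : (A \ H).card * ((A \ H).card - 1) ≤ k ^ 2 := by
        rw [sq]; exact Nat.mul_le_mul hLk (by omega)
      refine le_trans (by exact_mod_cast card_packings_head_le k r hLA)
        (ih (g + 1) (addClique G (A \ H)) (by omega) ?_ ?_ ?_)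
      · intro v
        rw [degree_addClique G _ hLi]
        split_ifs with hv
        · have hvH : ¬ (D - k < G.degree v) := by
            simpa [hH] using (Finset.mem_sdiff.1 hv).2
          have : (((A \ H).card - 1 : ℕ) : ℝ) ≤ k := by
            exact_mod_cast (show (A \ H).card - 1 ≤ k by omega)
          push_cast
          linarith
        · simpa using hdeg v
      · rw [sum_degree_addClique G _ hLi]
        linarith
      · rw [sum_degree_addClique G _ hLi]
        linarith
    have hbad' : ∀ A ∈ {A ∈ I | q + 1 ≤ (A ∩ H).card},
        (({B ∈ packings G k (r + 1) | B 0 = A} :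
          Finset (Fin (r + 1) → Finset V)).card : ℝ) ≤
        N ^ r * (Real.exp (-(y * (g * r + r.choose 2))) * P ^ r) := by
      intro A _
      refine le_trans ?_ (ih g G (by omega) hdeg hlow hup)
      have := card_packings_head_le (G := G) k r (Finset.empty_subset A)
      rw [addClique_empty] at this
      exact_mod_cast this
    have hIcard : (({A ∈ I | ¬ q + 1 ≤ (A ∩ H).card}).card : ℝ) ≤ N * Real.exp (-(y * g)) := by
      calc _ ≤ (I.card : ℝ) := by exact_mod_cast Finset.card_filter_le _ _
        _ ≤ _ := card_indepSets_le G hδ hδ2 hdeg k hkD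
        _ ≤ _ := by
          have h1 : (g : ℝ) * ((k - q) * (k - q - 1) : ℕ) ≤ ∑ v, (G.degree v : ℝ) := by
            exact_mod_cast hlow
          have : 0 ≤ 1 - 2 * δ := by linarith
          have : 0 ≤ 1 - δ := by linarith
          rw [hy, div_mul_eq_mul_div, mul_assoc _ _ (g : ℝ), mul_comm _ (g : ℝ)]
          gcongr
    have hBcard : (({A ∈ I | q + 1 ≤ (A ∩ H).card}).card : ℝ) ≤ N * p := by
      refine le_trans ?_ (hbad H hHcard)
      refine Nat.cast_le.2 (Finset.card_le_card (Finset.filter_subset_filter _ fun A hA => ?_))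
      have := ((mem_indepExtensions G).1 hA).2.1
      simpa [Finset.mem_powersetCard] using this
    have hexp : Real.exp (-(y * (g * r + r.choose 2))) ≤
        Real.exp (-(y * (g * (r + 1 : ℕ) + (r + 1).choose 2))) * Real.exp (y * T) := by
      rw [← Real.exp_add, Nat.choose_succ_succ' r 1, Nat.choose_one_right]
      refine Real.exp_le_exp.2 ?_
      have : (g : ℝ) + r ≤ T := by exact_mod_cast (show g + r ≤ T by omega)
      push_cast
      nlinarith [mul_le_mul_of_nonneg_left this hy0]
    calc ((packings G k (r + 1)).card : ℝ)
        = ∑ A ∈ {A ∈ I | q + 1 ≤ (A ∩ H).card}, (({B ∈ packings G k (r + 1) | B 0 = A} :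
            Finset (Fin (r + 1) → Finset V)).card : ℝ) +
          ∑ A ∈ {A ∈ I | ¬ q + 1 ≤ (A ∩ H).card}, (({B ∈ packings G k (r + 1) | B 0 = A} :
            Finset (Fin (r + 1) → Finset V)).card : ℝ) := by
          rw [hsum, Finset.sum_filter_add_sum_filter_not]
          push_cast; rfl
      _ ≤ N * p * (N ^ r * (Real.exp (-(y * (g * r + r.choose 2))) * P ^ r)) +
          N * Real.exp (-(y * g)) *
            (N ^ r * (Real.exp (-(y * ((g + 1 : ℕ) * r + r.choose 2))) * P ^ r)) := by
          refine add_le_add ((Finset.sum_le_sum hbad').trans ?_)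
            ((Finset.sum_le_sum hgood).trans ?_)
          · rw [Finset.sum_const, nsmul_eq_mul]
            gcongr
          · rw [Finset.sum_const, nsmul_eq_mul]
            gcongr
      _ ≤ N * p * (N ^ r * (Real.exp (-(y * (g * (r + 1 : ℕ) + (r + 1).choose 2))) *
            Real.exp (y * T) * P ^ r)) +
          N ^ (r + 1) * (Real.exp (-(y * (g * (r + 1 : ℕ) + (r + 1).choose 2))) * P ^ r) := by
          refine add_le_add (by gcongr) (le_of_eq ?_)
          rw [show -(y * ((g : ℝ) * (r + 1 : ℕ) + (r + 1).choose 2)) =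
            -(y * g) + -(y * ((g + 1 : ℕ) * r + r.choose 2)) by
              rw [Nat.choose_succ_succ' r 1, Nat.choose_one_right]; push_cast; ring, Real.exp_add]
          ring
      _ = _ := by rw [hP]; ring

end Packing

theorem zeta_le {n k t : ℕ} {Q : ℝ} (hQ : 0 ≤ Q)
    (h : ((packings (⊥ : SimpleGraph (Fin n)) k t).card : ℝ) ≤ (n.choose k : ℝ) ^ t * Q) :
    zeta n k t ≤ Q := by
  refine div_le_of_le_mul₀ (by positivity) hQ ?_
  rw [mul_comm]
  refine le_trans (le_of_eq ?_) h
  rw [← Nat.card_eq_finsetCard]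
  congr 1
  refine Nat.card_congr (Equiv.subtypeEquivRight fun B => ?_)
  rw [mem_packings]
  simp [SimpleGraph.isIndepSet_iff, Set.Pairwise]

theorem zeta_le_exp {n k t q : ℕ} {δ y ρ : ℝ} (hn : 0 < n) (hk0 : 0 < k) (hδ : 0 < δ)
    (hδ2 : δ ≤ 1 / 2) (hkn : 2 * (k : ℝ) ^ 2 ≤ δ * n)
    (hy : y = (1 - δ) * (1 - 2 * δ) * (k.choose 2) * ((k - q) * (k - q - 1) : ℕ) / (n : ℝ) ^ 2)
    (hρ : ρ = 2 * t * k ^ 3 / (δ * n ^ 2))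
    (hρy : 2 ^ k * ρ ^ q * Real.exp (y * t) ≤ 1) :
    zeta n k t ≤ Real.exp (-(y * t.choose 2) + t * ρ) := by
  have hnR : (0 : ℝ) < n := by exact_mod_cast hn
  have hkR : (0 : ℝ) < k := by exact_mod_cast hk0
  have : Nonempty (Fin n) := ⟨⟨0, hn⟩⟩
  have hρ0 : 0 ≤ ρ := by rw [hρ]; positivity
  have hbad : ∀ H : Finset (Fin n), H.card * (δ * n / k - k) ≤ t * (k : ℝ) ^ 2 →
      (({A ∈ Finset.powersetCard k Finset.univ | q + 1 ≤ (A ∩ H).card} :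
        Finset (Finset (Fin n))).card : ℝ) ≤
        (Fintype.card (Fin n)).choose k * (2 ^ k * ρ ^ (q + 1)) := by
    intro H hH
    refine (card_powersetCard_inter_le_mul_pow H k (q + 1)).trans ?_
    rw [Fintype.card_fin]
    have hHρ : (H.card : ℝ) / n ≤ ρ := by
      have h1 : δ * n / (2 * k) ≤ δ * n / k - k := by
        have : δ * n / k - k - δ * n / (2 * k) = (δ * n - 2 * k ^ 2) / (2 * k) := by
          field_simp; ring
        have h2 : 0 ≤ (δ * n - 2 * (k : ℝ) ^ 2) / (2 * k) := by
          apply div_nonneg <;> linarith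
        linarith
      have h2 : (H.card : ℝ) * (δ * n / (2 * k)) ≤ t * (k : ℝ) ^ 2 :=
        (mul_le_mul_of_nonneg_left h1 (Nat.cast_nonneg _)).trans hH
      rw [mul_div_assoc', div_le_iff₀ (by positivity)] at h2
      rw [hρ, div_le_div_iff₀ hnR (by positivity)]
      nlinarith
    gcongr
  have h := card_packings_le (V := Fin n) (y := y) (D := δ * n / k)
    (p := 2 ^ k * ρ ^ (q + 1)) (T := t) hδ.le hδ2
    (by rw [Fintype.card_fin, mul_div_cancel₀ _ hkR.ne']) (by positivity)
    (by rw [Fintype.card_fin]; exact hy) hbad t 0 ⊥ (by omega)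
    (by intro v; rw [SimpleGraph.bot_degree, Nat.cast_zero]; positivity) (by simp) (by simp)
  rw [Fintype.card_fin] at h
  refine (zeta_le (by positivity) h).trans ?_
  have hP : 1 + 2 ^ k * ρ ^ (q + 1) * Real.exp (y * t) ≤ Real.exp ρ := by
    have := Real.add_one_le_exp ρ
    have h2 : 2 ^ k * ρ ^ (q + 1) * Real.exp (y * t) =
        (2 ^ k * ρ ^ q * Real.exp (y * t)) * ρ := by ring
    nlinarith
  rw [Real.exp_add, Real.exp_nat_mul]
  simp only [Nat.cast_zero, zero_mul, zero_add]
  gcongr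

theorem exp_one_pow_le_four_pow (k : ℕ) : Real.exp k ≤ 4 ^ k := by
  rw [← mul_one (k : ℝ), Real.exp_nat_mul]
  have := Real.exp_one_lt_d9
  gcongr
  linarith

theorem exponent_ge {n k t q : ℕ} {δ ε y ρ : ℝ} (hnR : (0 : ℝ) < n) (hkR : (0 : ℝ) < k)
    (htR : (0 : ℝ) < t) (hδ0 : 0 < δ) (hδ16 : δ ≤ 1 / 16) (hεδ2 : ε ≤ δ ^ 2 / 4) (hεδ : ε ≤ δ)
    (hεk : 1 ≤ ε * k) (hεt : 1 ≤ ε * t) (hqδ : (q : ℝ) ≤ δ * k)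
    (hy : y = (1 - δ) * (1 - 2 * δ) * (k.choose 2) * ((k - q) * (k - q - 1) : ℕ) / (n : ℝ) ^ 2)
    (hρ : ρ = 2 * t * k ^ 3 / (δ * n ^ 2)) :
    (1 - 14 * δ) * ((t : ℝ) ^ 2 * k ^ 4 / (4 * n ^ 2)) ≤ y * t.choose 2 - t * ρ := by
  set X : ℝ := (t : ℝ) ^ 2 * k ^ 4 / (4 * n ^ 2) with hX
  have hX0 : 0 < X := by positivity
  have hb0 : 0 ≤ 1 - 2 * δ := by linarith
  have hρX : t * ρ ≤ 2 * δ * X := by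
    have h1 : t * ρ = (8 / (δ * k)) * X := by
      rw [hρ, hX]; field_simp; ring
    rw [h1]
    gcongr
    rw [div_le_iff₀ (by positivity)]
    have := mul_le_mul_of_nonneg_right hεδ2 hkR.le
    linarith
  have hyX : (1 - 12 * δ) * X ≤ y * t.choose 2 := by
    have hbern : 1 - 12 * δ ≤ (1 - 2 * δ) ^ 6 := by
      have := one_add_mul_le_pow (show (-2 : ℝ) ≤ -(2 * δ) by linarith) 6
      rw [← sub_eq_add_neg] at this
      push_cast at this
      linarith
    have hδk : 1 ≤ δ * k := hεk.trans (by gcongr)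
    have hδt : 1 ≤ δ * t := hεt.trans (by gcongr)
    have hC : (1 - 2 * δ) * k ^ 2 / 2 ≤ ((k.choose 2 : ℕ) : ℝ) := by
      rw [Nat.cast_choose_two]
      nlinarith
    have hT : (1 - 2 * δ) * t ^ 2 / 2 ≤ ((t.choose 2 : ℕ) : ℝ) := by
      rw [Nat.cast_choose_two]
      nlinarith
    have hE : (1 - 2 * δ) * k * ((1 - 2 * δ) * k) ≤ (((k - q) * (k - q - 1) : ℕ) : ℝ) := by
      have h1 : (1 - 2 * δ) * k ≤ ((k - q : ℕ) : ℝ) - 1 := by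
        have : (k : ℝ) ≤ ((k - q : ℕ) : ℝ) + q := by exact_mod_cast (show k ≤ k - q + q by omega)
        linarith
      have h2 : ((k - q : ℕ) : ℝ) ≤ ((k - q - 1 : ℕ) : ℝ) + 1 := by
        exact_mod_cast (show k - q ≤ k - q - 1 + 1 by omega)
      push_cast
      gcongr <;> linarith
    calc (1 - 12 * δ) * X ≤ (1 - 2 * δ) ^ 6 * X := by gcongr
      _ = (1 - 2 * δ) * (1 - 2 * δ) * ((1 - 2 * δ) * k ^ 2 / 2) *
          ((1 - 2 * δ) * k * ((1 - 2 * δ) * k)) / n ^ 2 * ((1 - 2 * δ) * t ^ 2 / 2) := by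
          rw [hX]; field_simp; ring
      _ ≤ y * t.choose 2 := by
          have : 0 ≤ 1 - δ := by linarith
          rw [hy]
          gcongr
          linarith
  linarith

theorem rate_mul_le {n k t q : ℕ} {δ ε y : ℝ} (hnR : (0 : ℝ) < n) (hδ0 : 0 ≤ δ)
    (hδ2 : δ ≤ 1 / 2) (hε1 : ε ≤ 1) (htk : (t : ℝ) * k ^ 3 ≤ ε * n ^ 2)
    (hy : y = (1 - δ) * (1 - 2 * δ) * (k.choose 2) * ((k - q) * (k - q - 1) : ℕ) / (n : ℝ) ^ 2) :
    y * t ≤ k := by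
  have h1 : ((k.choose 2 : ℕ) : ℝ) ≤ (k : ℝ) ^ 2 := by
    exact_mod_cast Nat.choose_le_pow k 2
  have h2 : (((k - q) * (k - q - 1) : ℕ) : ℝ) ≤ (k : ℝ) ^ 2 := by
    have : (k - q) * (k - q - 1) ≤ k * k := Nat.mul_le_mul (by omega) (by omega)
    rw [sq]; exact_mod_cast this
  have h3 : (1 - δ) * (1 - 2 * δ) ≤ 1 :=
    mul_le_one₀ (by linarith) (by linarith) (by linarith)
  have h4 : 0 ≤ (1 - δ) * (1 - 2 * δ) := mul_nonneg (by linarith) (by linarith)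
  rw [hy, div_mul_eq_mul_div, div_le_iff₀ (by positivity)]
  calc _ ≤ 1 * (k : ℝ) ^ 2 * (k : ℝ) ^ 2 * t := by gcongr
    _ = k * (t * k ^ 3) := by ring
    _ ≤ k * (ε * n ^ 2) := by gcongr
    _ ≤ k * (1 * n ^ 2) := by gcongr
    _ = _ := by ring

theorem two_pow_mul_pow_mul_exp_le_one {k m q : ℕ} {ρ x : ℝ} (hkq : k ≤ 2 * m * q)
    (hρ0 : 0 ≤ ρ) (hρ : ρ ≤ (1 / 8) ^ (2 * m)) (hx : x ≤ k) :
    2 ^ k * ρ ^ q * Real.exp x ≤ 1 := by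
  calc _ ≤ 2 ^ k * ((1 / 8) ^ (2 * m)) ^ q * Real.exp k := by gcongr
    _ ≤ 2 ^ k * ((1 / 8) ^ (2 * m)) ^ q * 4 ^ k := by gcongr; exact exp_one_pow_le_four_pow k
    _ = 8 ^ k * (1 / 8) ^ (2 * m * q) := by
        rw [← pow_mul, mul_right_comm, ← mul_pow]; norm_num
    _ ≤ 8 ^ k * (1 / 8) ^ k := by
        refine mul_le_mul_of_nonneg_left ?_ (by positivity)
        exact pow_le_pow_of_le_one (by norm_num) (by norm_num) hkq
    _ = 1 := by rw [← mul_pow]; norm_num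

/-- For every `η > 0` there are `ε > 0` and `N` such that for all `n ≥ N` and integers
`k, t` with `1/ε ≤ k ≤ ε√n` and `1/ε ≤ t ≤ ε·n²/k³`,
`ζ(n,k,t) < exp(-(1-η)t²k⁴/(4n²))`. -/
theorem stmt3 (η : ℝ) (hη : 0 < η) :
    ∃ ε : ℝ, 0 < ε ∧ ∃ N : ℕ, ∀ n, N ≤ n →
      ∀ k t : ℕ, 1 / ε ≤ (k : ℝ) → (k : ℝ) ≤ ε * Real.sqrt n →
        1 / ε ≤ (t : ℝ) → (t : ℝ) ≤ ε * (n : ℝ) ^ 2 / (k : ℝ) ^ 3 →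
        zeta n k t <
          Real.exp (-((1 - η) * (t : ℝ) ^ 2 * (k : ℝ) ^ 4 / (4 * (n : ℝ) ^ 2))) := by
  obtain ⟨m, hm⟩ := exists_nat_gt (max (16 / η) 16)
  have hm16 : (16 : ℝ) < m := (le_max_right _ _).trans_lt hm
  have hmη : 16 / η < m := (le_max_left _ _).trans_lt hm
  have hm0 : (0 : ℝ) < m := by linarith
  have hmpos : 0 < m := by exact_mod_cast hm0
  obtain ⟨δ, hδdef⟩ : ∃ x : ℝ, x = 1 / m := ⟨_, rfl⟩
  have hδ0 : 0 < δ := by rw [hδdef]; positivity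
  have hδη : 16 * δ < η := by
    rw [div_lt_iff₀ hη] at hmη
    rw [hδdef, mul_one_div, div_lt_iff₀ hm0]; linarith
  have hδ16 : δ < 1 / 16 := hδdef ▸ one_div_lt_one_div_of_lt (by norm_num) hm16
  obtain ⟨w, hw⟩ : ∃ x : ℝ, x = (1 / 8) ^ (2 * m) := ⟨_, rfl⟩
  have hw0 : 0 < w := by rw [hw]; positivity
  have hw1 : w ≤ 1 := hw ▸ pow_le_one₀ (by norm_num) (by norm_num)
  obtain ⟨ε, hε⟩ : ∃ x : ℝ, x = δ ^ 2 * w / 4 := ⟨_, rfl⟩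
  have hε0 : 0 < ε := by rw [hε]; positivity
  have hεδ2 : ε ≤ δ ^ 2 / 4 := by rw [hε]; nlinarith [sq_nonneg δ]
  have hεδ : ε ≤ δ := by nlinarith
  refine ⟨ε, hε0, 1, fun n hn k t hk1 hk2 ht1 ht2 => ?_⟩
  have hnR : (0 : ℝ) < n := by exact_mod_cast hn
  have hεk : 1 ≤ ε * k := by rwa [div_le_iff₀ hε0, mul_comm] at hk1
  have hεt : 1 ≤ ε * t := by rwa [div_le_iff₀ hε0, mul_comm] at ht1
  have hkR : (0 : ℝ) < k := by
    by_contra h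
    nlinarith
  have htR : (0 : ℝ) < t := by
    by_contra h
    nlinarith
  have hkn : (k : ℝ) ^ 2 ≤ ε ^ 2 * n := by
    calc (k : ℝ) ^ 2 ≤ (ε * Real.sqrt n) ^ 2 := by gcongr
      _ = _ := by rw [mul_pow, Real.sq_sqrt hnR.le]
  have htk : (t : ℝ) * k ^ 3 ≤ ε * n ^ 2 := by rwa [le_div_iff₀ (by positivity)] at ht2
  have hmk : m ≤ k := by
    have h1 : 1 ≤ δ * k := hεk.trans (by gcongr)
    rw [hδdef, one_div, inv_mul_eq_div, le_div_iff₀ hm0, one_mul] at h1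
    exact_mod_cast h1
  set q := k / m with hq
  have hq1 : 1 ≤ q := (Nat.one_le_div_iff hmpos).2 hmk
  have hkq : k ≤ 2 * m * q := by
    have := Nat.lt_mul_div_succ k hmpos
    rw [← hq] at this
    nlinarith
  have hqδ : (q : ℝ) ≤ δ * k := by
    rw [hδdef, one_div, inv_mul_eq_div]
    exact Nat.cast_div_le
  set y : ℝ := (1 - δ) * (1 - 2 * δ) * (k.choose 2) * ((k - q) * (k - q - 1) : ℕ) /
    (n : ℝ) ^ 2 with hy
  obtain ⟨ρ, hρ⟩ : ∃ x : ℝ, x = 2 * t * k ^ 3 / (δ * n ^ 2) := ⟨_, rfl⟩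
  have hρ0 : 0 ≤ ρ := by rw [hρ]; positivity
  have hρw : ρ ≤ w := by
    rw [hρ, div_le_iff₀ (by positivity)]
    have h1 : 2 * ε ≤ w * δ := by rw [hε]; nlinarith [mul_pos hw0 hδ0]
    nlinarith [sq_nonneg (n : ℝ)]
  have hyt : y * t ≤ k :=
    rate_mul_le hnR hδ0.le (by linarith) (by linarith) htk hy
  have hρy := two_pow_mul_pow_mul_exp_le_one hkq hρ0 (hρw.trans_eq hw) hyt
  have hk0 : 0 < k := by exact_mod_cast hkR
  have hkn' : 2 * (k : ℝ) ^ 2 ≤ δ * n := by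
    have h1 : ε ^ 2 ≤ δ ^ 2 := pow_le_pow_left₀ hε0.le hεδ 2
    have h2 : δ ^ 2 ≤ 1 / 16 * δ := by rw [sq]; exact mul_le_mul_of_nonneg_right hδ16.le hδ0.le
    have h3 : 2 * ε ^ 2 ≤ δ := by linarith
    have h4 := mul_le_mul_of_nonneg_right h3 hnR.le
    linarith
  refine (zeta_le_exp hn hk0 hδ0 (by linarith) hkn' hy hρ hρy).trans_lt
    (Real.exp_lt_exp.2 ?_)
  have hmain := exponent_ge hnR hkR htR hδ0 hδ16.le hεδ2 hεδ hεk hεt hqδ hy hρ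
  have hX0 : 0 < (t : ℝ) ^ 2 * k ^ 4 / (4 * n ^ 2) := by positivity
  have hlt : (1 - η) * ((t : ℝ) ^ 2 * k ^ 4 / (4 * n ^ 2)) <
      (1 - 14 * δ) * ((t : ℝ) ^ 2 * k ^ 4 / (4 * n ^ 2)) := by
    gcongr
    linarith
  have hfin : (1 - η) * (t : ℝ) ^ 2 * k ^ 4 / (4 * n ^ 2) =
      (1 - η) * ((t : ℝ) ^ 2 * k ^ 4 / (4 * n ^ 2)) := by
    ring
  rw [hfin]
  linarith
end

section
/- Let q be a prime power, let l = q, let n be a positive multiple of l², and let s be an integer with 1 ≤ s ≤ l + 1. Then there exists a nearly-disjoint l-uniform hypergraph ℋ on n vertices with exactly s·n/l edges such that for every matching {e_1,…,e_i} ⊆ ℋ, the number of edges of ℋ disjoint from every e_j (1 ≤ j ≤ i) is at least n/l − i. Consequently, for any m ≤ n/l, if e_1,…,e_m are drawn uniformly and independently from ℋ, then P({e_1,…,e_m} is a matching of size m) ≥ ∏_{i=0}^{m−1} (n/l − i)/(s·n/l). -/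
/-- A family of pairwise disjoint sets. -/
def IsSetMatching {α : Type*} (M : Finset (Finset α)) : Prop :=
  ∀ e ∈ M, ∀ f ∈ M, e ≠ f → Disjoint e f

/-- Ordered matchings of size `m` in `H`. -/
abbrev OrderedMatching {α : Type*} (H : Finset (Finset α)) (m : ℕ) : Type _ :=
  {A : Fin m → Finset α // (∀ i, A i ∈ H) ∧ ∀ i j, i ≠ j → Disjoint (A i) (A j)}

/-- If every matching `M` in `H` leaves at least `K - |M|` edges disjoint from it, then `H` has at
least `K (K - 1) ⋯ (K - m + 1)` ordered matchings of size `m`. -/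
theorem descFactorial_le_card_orderedMatching {α : Type*} [Fintype α] [DecidableEq α]
    (H : Finset (Finset α)) (K : ℕ)
    (hK : ∀ M ⊆ H, IsSetMatching M →
      K ≤ M.card + (H.filter fun e => ∀ f ∈ M, Disjoint e f).card) (m : ℕ) :
    K.descFactorial m ≤ Nat.card (OrderedMatching H m) := by
  induction m with
  | zero =>
    rw [Nat.descFactorial_zero]
    have : Nonempty (OrderedMatching H 0) := ⟨⟨Fin.elim0, fun i => i.elim0, fun i => i.elim0⟩⟩
    exact Nat.card_pos
  | succ m ih =>
    let E (A : OrderedMatching H m) : Finset (Finset α) :=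
      H.filter fun e => ∀ i, Disjoint e (A.1 i)
    have hE (A : OrderedMatching H m) : K - m ≤ Nat.card (E A) := by
      have h := hK (Finset.univ.image A.1) (by
        intro e he
        obtain ⟨i, -, rfl⟩ := Finset.mem_image.1 he
        exact A.2.1 i) (by
        intro e he f hf hef
        obtain ⟨i, -, rfl⟩ := Finset.mem_image.1 he
        obtain ⟨j, -, rfl⟩ := Finset.mem_image.1 hf
        exact A.2.2 i j fun hij => hef (hij ▸ rfl))
      have h₁ : (Finset.univ.image A.1).card ≤ m := by
        simpa using Finset.card_image_le (s := Finset.univ) (f := A.1)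
      have h₂ : (H.filter fun e => ∀ f ∈ Finset.univ.image A.1, Disjoint e f) = E A := by
        ext e
        simp [E]
      rw [h₂] at h
      rw [Nat.card_eq_fintype_card, Fintype.card_coe]
      omega
    let ext (x : Σ A : OrderedMatching H m, E A) : OrderedMatching H (m + 1) :=
      ⟨Fin.snoc (α := fun _ => Finset α) x.1.1 x.2.1, by
        obtain ⟨A, e, he⟩ := x
        obtain ⟨heH, heA⟩ := Finset.mem_filter.1 he
        refine ⟨fun i => ?_, fun i j hij => ?_⟩
        · cases i using Fin.lastCases with
          | last => simpa using heH
          | cast i => simpa using A.2.1 i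
        · cases i using Fin.lastCases with
          | last =>
            cases j using Fin.lastCases with
            | last => exact absurd rfl hij
            | cast j => simpa using heA j
          | cast i =>
            cases j using Fin.lastCases with
            | last => simpa using (heA i).symm
            | cast j => simpa using A.2.2 i j fun h => hij (h ▸ rfl)⟩
    have hext : Function.Injective ext := by
      rintro ⟨⟨A, hA⟩, e, he⟩ ⟨⟨B, hB⟩, f, hf⟩ h
      obtain ⟨rfl, rfl⟩ := (Fin.snoc_inj (α := fun _ => Finset α)).1 (congrArg Subtype.val h)
      rfl
    calc K.descFactorial (m + 1) = K.descFactorial m * (K - m) := by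
          rw [Nat.descFactorial_succ, mul_comm]
      _ ≤ Nat.card (OrderedMatching H m) * (K - m) := Nat.mul_le_mul_right _ ih
      _ ≤ Nat.card (Σ A : OrderedMatching H m, E A) := by
          classical
          rw [Nat.card_sigma, Nat.card_eq_fintype_card, ← smul_eq_mul, ← Finset.card_univ]
          exact Finset.card_nsmul_le_sum _ _ _ fun A _ => hE A
      _ ≤ Nat.card (OrderedMatching H (m + 1)) := Nat.card_le_card_of_injective _ hext

theorem Nat.cast_descFactorial_eq_prod_range {R : Type*} [CommRing R] {K m : ℕ} (h : m ≤ K) :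
    (K.descFactorial m : R) = ∏ i ∈ Finset.range m, ((K : R) - i) := by
  rw [Nat.descFactorial_eq_prod_range, Nat.cast_prod]
  refine Finset.prod_congr rfl fun i hi => Nat.cast_sub ?_
  have := Finset.mem_range.1 hi
  omega

namespace AffinePlane

variable {F : Type*} [Field F]

/-- The linear form on the plane over `F` whose level sets are the lines of a given slope;
`none` stands for the vertical direction. -/
def form : Option F → F × F → F
  | none, v => v.1
  | some a, v => v.2 - a * v.1

theorem form_pair_injective {d d' : Option F} (h : d ≠ d') :
    Function.Injective fun v => (form d v, form d' v) := by
  rintro ⟨x, y⟩ ⟨x', y'⟩ hv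
  obtain ⟨h₁, h₂⟩ := Prod.mk.inj hv
  rcases d with _ | a <;> rcases d' with _ | b <;> simp only [form] at h₁ h₂
  · exact absurd rfl h
  · subst h₁
    simpa using h₂
  · subst h₂
    simpa using h₁
  · have hab : a - b ≠ 0 := sub_ne_zero.2 fun hab => h (hab ▸ rfl)
    have hx : x = x' := mul_left_cancel₀ hab (by linear_combination h₂ - h₁)
    subst hx
    simpa using h₁

theorem form_pair_bijective [Finite F] {d d' : Option F} (h : d ≠ d') :
    Function.Bijective fun v => (form d v, form d' v) :=
  Finite.injective_iff_bijective.1 (form_pair_injective h)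

variable {ι V : Type*} [Fintype V] [DecidableEq ι] [DecidableEq F]

/-- The line with slope `d` and offset `c` in the `t`-th of a family of disjoint affine planes,
where the points of all planes are labelled by `V`. -/
def line (φ : V ≃ ι × F × F) (t : ι) (d : Option F) (c : F) : Finset V :=
  Finset.univ.filter fun v => (φ v).1 = t ∧ form d (φ v).2 = c

variable (φ : V ≃ ι × F × F)

@[simp]
theorem mem_line {t : ι} {d : Option F} {c : F} {v : V} :
    v ∈ line φ t d c ↔ (φ v).1 = t ∧ form d (φ v).2 = c := by
  simp [line]

theorem disjoint_line_of_ne {t t' : ι} (h : t ≠ t') (d d' : Option F) (c c' : F) :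
    Disjoint (line φ t d c) (line φ t' d' c') := by
  rw [Finset.disjoint_left]
  intro v hv hv'
  exact h (((mem_line φ).1 hv).1.symm.trans ((mem_line φ).1 hv').1)

theorem disjoint_line_of_offset_ne (t : ι) (d : Option F) {c c' : F} (h : c ≠ c') :
    Disjoint (line φ t d c) (line φ t d c') := by
  rw [Finset.disjoint_left]
  intro v hv hv'
  exact h (((mem_line φ).1 hv).2.symm.trans ((mem_line φ).1 hv').2)

theorem not_disjoint_line [Finite F] (t : ι) {d d' : Option F} (h : d ≠ d') (c c' : F) :
    ¬ Disjoint (line φ t d c) (line φ t d' c') := by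
  obtain ⟨w, hw⟩ := (form_pair_bijective h).2 (c, c')
  obtain ⟨h₁, h₂⟩ := Prod.mk.inj hw
  rw [Finset.not_disjoint_iff]
  exact ⟨φ.symm (t, w), by simpa using h₁, by simpa using h₂⟩

theorem card_line [Fintype F] (t : ι) (d : Option F) (c : F) :
    (line φ t d c).card = Fintype.card F := by
  obtain ⟨d', h⟩ := exists_ne d
  rw [← Finset.card_univ]
  refine Finset.card_bij (fun v _ => form d' (φ v).2) (fun _ _ => Finset.mem_univ _) ?_ ?_
  · intro v hv w hw hvw
    rw [mem_line] at hv hw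
    refine φ.injective (Prod.ext (hv.1.trans hw.1.symm) (form_pair_injective h ?_))
    exact Prod.ext hvw (hv.2.trans hw.2.symm)
  · intro b _
    obtain ⟨w, hw⟩ := (form_pair_bijective h).2 (b, c)
    obtain ⟨h₁, h₂⟩ := Prod.mk.inj hw
    exact ⟨φ.symm (t, w), by simpa using h₂, by simpa using h₁⟩

theorem line_nonempty [Fintype F] (t : ι) (d : Option F) (c : F) : (line φ t d c).Nonempty := by
  rw [← Finset.card_pos, card_line]
  exact Fintype.card_pos

theorem card_line_inter_le_one [DecidableEq V] {t t' : ι} {d d' : Option F} {c c' : F}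
    (h : line φ t d c ≠ line φ t' d' c') : (line φ t d c ∩ line φ t' d' c').card ≤ 1 := by
  by_cases ht : t = t'
  swap
  · simp [Finset.disjoint_iff_inter_eq_empty.1 (disjoint_line_of_ne φ ht d d' c c')]
  subst ht
  by_cases hd : d = d'
  · subst hd
    have hc : c ≠ c' := fun hc => h (hc ▸ rfl)
    simp [Finset.disjoint_iff_inter_eq_empty.1 (disjoint_line_of_offset_ne φ t d hc)]
  · rw [Finset.card_le_one]
    intro v hv w hw
    simp only [Finset.mem_inter, mem_line] at hv hw
    refine φ.injective (Prod.ext (hv.1.1.trans hw.1.1.symm) (form_pair_injective hd ?_))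
    exact Prod.ext (hv.1.2.trans hw.1.2.symm) (hv.2.2.trans hw.2.2.symm)

theorem line_inj [Fintype F] {t t' : ι} {d d' : Option F} {c c' : F}
    (h : line φ t d c = line φ t' d' c') : t = t' ∧ d = d' ∧ c = c' := by
  have hnd : ¬ Disjoint (line φ t d c) (line φ t' d' c') := by
    rw [← h, disjoint_self]
    exact (line_nonempty φ t d c).ne_empty
  obtain rfl : t = t' := by
    by_contra ht
    exact hnd (disjoint_line_of_ne φ ht d d' c c')
  obtain rfl : d = d' := by
    by_contra hd
    obtain ⟨b, hb⟩ := exists_ne c'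
    refine not_disjoint_line φ t hd c b ?_
    rw [h]
    exact disjoint_line_of_offset_ne φ t d' hb.symm
  refine ⟨rfl, rfl, ?_⟩
  by_contra hc
  exact hnd (disjoint_line_of_offset_ne φ t d hc)

variable [DecidableEq V] [Fintype ι] [Fintype F]

/-- All lines with slope in `S` in a family of disjoint affine planes. -/
def lines (S : Finset (Option F)) : Finset (Finset V) :=
  (Finset.univ ×ˢ S ×ˢ Finset.univ).image fun x : ι × Option F × F => line φ x.1 x.2.1 x.2.2

theorem mem_lines {S : Finset (Option F)} {e : Finset V} :
    e ∈ lines φ S ↔ ∃ t, ∃ d ∈ S, ∃ c, line φ t d c = e := by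
  simp [lines]

theorem card_lines (S : Finset (Option F)) :
    (lines φ S).card = Fintype.card ι * (S.card * Fintype.card F) := by
  rw [lines, Finset.card_image_of_injective]
  · simp
  · rintro ⟨t, d, c⟩ ⟨t', d', c'⟩ h
    obtain ⟨rfl, rfl, rfl⟩ := line_inj φ h
    rfl

/-- Every matching consisting of lines uses at most one parallel class in each plane; the unused
lines of these classes are disjoint from the matching. -/
theorem le_card_add_card_disjoint {S : Finset (Option F)} (hS : S.Nonempty)
    {M : Finset (Finset V)} (hMS : M ⊆ lines φ S) (hM : IsSetMatching M) :
    Fintype.card ι * Fintype.card F ≤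
      M.card + ((lines φ S).filter fun e => ∀ f ∈ M, Disjoint e f).card := by
  have hD (t : ι) : ∃ d ∈ S, ∀ d' ∈ S, ∀ c', line φ t d' c' ∈ M → d' = d := by
    by_cases h : ∃ d ∈ S, ∃ c, line φ t d c ∈ M
    · obtain ⟨d, hd, c, hc⟩ := h
      refine ⟨d, hd, fun d' _ c' hc' => ?_⟩
      by_contra hne
      refine not_disjoint_line φ t hne c' c (hM _ hc' _ hc fun heq => hne ?_)
      exact (line_inj φ heq).2.1
    · obtain ⟨d, hd⟩ := hS
      exact ⟨d, hd, fun d' hd' c' hc' => absurd ⟨d', hd', c', hc'⟩ h⟩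
  choose D hDS hDM using hD
  let T : Finset (Finset V) := Finset.univ.image fun x : ι × F => line φ x.1 (D x.1) x.2
  have hT : T.card = Fintype.card ι * Fintype.card F := by
    rw [Finset.card_image_of_injective, Finset.card_univ, Fintype.card_prod]
    rintro ⟨t, c⟩ ⟨t', c'⟩ h
    obtain ⟨rfl, -, rfl⟩ := line_inj φ h
    rfl
  have hsub : T \ M ⊆ (lines φ S).filter fun e => ∀ f ∈ M, Disjoint e f := by
    intro e he
    obtain ⟨heT, heM⟩ := Finset.mem_sdiff.1 he
    obtain ⟨⟨t, c⟩, -, rfl⟩ := Finset.mem_image.1 heT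
    refine Finset.mem_filter.2 ⟨(mem_lines φ).2 ⟨t, D t, hDS t, c, rfl⟩, fun f hf => ?_⟩
    obtain ⟨t', d', hd', c', rfl⟩ := (mem_lines φ).1 (hMS hf)
    by_cases ht : t = t'
    · subst ht
      obtain rfl := hDM t d' hd' c' hf
      exact disjoint_line_of_offset_ne φ t _ fun hc => heM (hc ▸ hf)
    · exact disjoint_line_of_ne φ ht _ _ _ _
  rw [← hT]
  have h₁ := Finset.card_le_card hsub
  have h₂ := Finset.card_le_card_sdiff_add_card (s := T) (t := M)
  omega

end AffinePlane

/-- For a prime power `l = q`, `n` a positive multiple of `l²`, and `1 ≤ s ≤ l+1`,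
there is a nearly-disjoint `l`-uniform hypergraph `H` on `n` vertices with exactly
`s·n/l` edges such that every matching `M ⊆ H` leaves at least `n/l - |M|` edges of `H`
disjoint from all members of `M`; consequently, for any `m ≤ n/l`, `m` edges drawn
uniformly and independently from `H` form a matching of size `m` with probability at
least `∏_{i=0}^{m-1} (n/l - i)/(s·n/l)`. -/
theorem stmt5 (q l n s : ℕ) (hq : ∃ p r : ℕ, p.Prime ∧ 0 < r ∧ q = p ^ r)
    (hl : l = q) (hn : 0 < n) (hdvd : l ^ 2 ∣ n) (hs1 : 1 ≤ s) (hs2 : s ≤ l + 1) :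
    ∃ H : Finset (Finset (Fin n)),
      (∀ e ∈ H, e.card = l) ∧
      (∀ e ∈ H, ∀ f ∈ H, e ≠ f → (e ∩ f).card ≤ 1) ∧
      H.card = s * (n / l) ∧
      (∀ M : Finset (Finset (Fin n)), M ⊆ H →
        (∀ e ∈ M, ∀ f ∈ M, e ≠ f → Disjoint e f) →
        ((n / l : ℕ) : ℝ) - (M.card : ℝ) ≤
          ((H.filter fun e => ∀ f ∈ M, Disjoint e f).card : ℝ)) ∧
      ∀ m : ℕ, m ≤ n / l →
        (∏ i ∈ Finset.range m, ((((n / l : ℕ) : ℝ) - (i : ℝ)) /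
            ((s : ℝ) * ((n / l : ℕ) : ℝ)))) ≤
          (Nat.card {A : Fin m → Finset (Fin n) //
              (∀ i, A i ∈ H) ∧ ∀ i j, i ≠ j → Disjoint (A i) (A j)} : ℝ) /
            ((H.card : ℝ) ^ m) := by
  classical
  obtain ⟨p, r, hp, hr, hpr⟩ := hq
  have : Fact p.Prime := ⟨hp⟩
  let F := GaloisField p r
  have : Fintype F := Fintype.ofFinite F
  have hF : Fintype.card F = l := by
    rw [← Nat.card_eq_fintype_card, GaloisField.card p r hr.ne', hl, hpr]
  have hl0 : 0 < l := hF ▸ Fintype.card_pos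
  obtain ⟨N, rfl⟩ := hdvd
  have hdiv : l ^ 2 * N / l = N * l := by
    rw [pow_two, mul_assoc, Nat.mul_div_cancel_left _ hl0, mul_comm]
  have φ : Fin (l ^ 2 * N) ≃ Fin N × F × F := Fintype.equivOfCardEq (by
    simp only [Fintype.card_fin, Fintype.card_prod, hF]
    ring)
  obtain ⟨S, -, hS⟩ := Finset.exists_subset_card_eq
    (s := (Finset.univ : Finset (Option F))) (n := s) (by simpa [hF] using hs2)
  have hSne : S.Nonempty := Finset.card_pos.1 (by omega)
  have hcard : (AffinePlane.lines φ S).card = s * (N * l) := by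
    rw [AffinePlane.card_lines, hF, hS, Fintype.card_fin]
    ring
  have hmatch : ∀ M ⊆ AffinePlane.lines φ S, IsSetMatching M →
      N * l ≤ M.card + ((AffinePlane.lines φ S).filter fun e => ∀ f ∈ M, Disjoint e f).card := by
    intro M hMS hM
    simpa [hF] using AffinePlane.le_card_add_card_disjoint φ hSne hMS hM
  rw [hdiv]
  refine ⟨AffinePlane.lines φ S, ?_, ?_, hcard, ?_, ?_⟩
  · intro e he
    obtain ⟨t, d, -, c, rfl⟩ := (AffinePlane.mem_lines φ).1 he
    rw [AffinePlane.card_line, hF]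
  · intro e he f hf hef
    obtain ⟨t, d, -, c, rfl⟩ := (AffinePlane.mem_lines φ).1 he
    obtain ⟨t', d', -, c', rfl⟩ := (AffinePlane.mem_lines φ).1 hf
    convert AffinePlane.card_line_inter_le_one φ hef
  · intro M hMS hM
    rw [sub_le_iff_le_add']
    refine (Nat.cast_le.2 (hmatch M hMS hM)).trans_eq ?_
    rw [Nat.cast_add]
  · intro m hm
    rw [Finset.prod_div_distrib, Finset.prod_const, Finset.card_range, hcard, Nat.cast_mul s,
      ← Nat.cast_descFactorial_eq_prod_range hm]
    gcongr
    exact descFactorial_le_card_orderedMatching _ _ hmatch m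
end

section
/- If ξ_1,…,ξ_n are bounded, negatively associated real random variables and ξ = ξ_1 + … + ξ_n, then for every real α and every λ > 0: P(ξ > α) ≤ e^{−λα}·E[e^{λξ}] ≤ e^{−λα}·∏_{i=1}^n E[e^{λξ_i}]. -/
open MeasureTheory

/-- Real random variables `ξ 0, …, ξ (n-1)` on a common probability space are
*negatively associated* if `E[fg] ≤ E[f]·E[g]` whenever there are disjoint
`I, J ⊆ {0,…,n-1}` such that `f` is a bounded coordinatewise nondecreasing function
of the coordinates in `I` and `g` is a bounded coordinatewise nondecreasing function
of the coordinates in `J`. -/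
def NegAssoc {Ω : Type*} [MeasurableSpace Ω] (μ : Measure Ω) {n : ℕ}
    (ξ : Fin n → Ω → ℝ) : Prop :=
  ∀ I J : Finset (Fin n), Disjoint I J →
    ∀ f g : (Fin n → ℝ) → ℝ, Monotone f → Monotone g →
      (∃ C, ∀ x, |f x| ≤ C) → (∃ C, ∀ x, |g x| ≤ C) →
      (∀ x y : Fin n → ℝ, (∀ i ∈ I, x i = y i) → f x = f y) →
      (∀ x y : Fin n → ℝ, (∀ j ∈ J, x j = y j) → g x = g y) →
      ∫ ω, (f fun i => ξ i ω) * (g fun i => ξ i ω) ∂μ ≤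
        (∫ ω, (f fun i => ξ i ω) ∂μ) * ∫ ω, (g fun i => ξ i ω) ∂μ

/-- For negatively associated variables, the expectation of a product of bounded nonnegative
nondecreasing functions of the individual variables is at most the product of expectations. -/
theorem NegAssoc.integral_prod_le {Ω : Type*} [MeasurableSpace Ω] {μ : Measure Ω}
    [IsProbabilityMeasure μ] {n : ℕ} {ξ : Fin n → Ω → ℝ} (hξ : NegAssoc μ ξ)
    {h : Fin n → ℝ → ℝ} (hmono : ∀ i, Monotone (h i)) (hnonneg : ∀ i x, 0 ≤ h i x)
    (hbdd : ∀ i, ∃ C, ∀ x, h i x ≤ C) (s : Finset (Fin n)) :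
    ∫ ω, ∏ i ∈ s, h i (ξ i ω) ∂μ ≤ ∏ i ∈ s, ∫ ω, h i (ξ i ω) ∂μ := by
  choose C hC using hbdd
  induction s using Finset.induction_on with
  | empty => simp
  | insert a s ha ih =>
    simp only [Finset.prod_insert ha]
    refine (hξ {a} s (Finset.disjoint_singleton_left.2 ha) (fun x => h a (x a))
      (fun x => ∏ i ∈ s, h i (x i)) (fun x y hxy => hmono a (hxy a))
      (fun x y hxy => Finset.prod_le_prod (fun i _ => hnonneg i _) fun i _ => hmono i (hxy i))
      ⟨C a, fun x => ?_⟩ ⟨∏ i ∈ s, C i, fun x => ?_⟩ (fun x y hxy => ?_)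
      (fun x y hxy => Finset.prod_congr rfl fun i hi => by rw [hxy i hi])).trans
      (mul_le_mul_of_nonneg_left ih (integral_nonneg fun ω => hnonneg a _))
    · rw [abs_of_nonneg (hnonneg a _)]
      exact hC a _
    · rw [abs_of_nonneg (Finset.prod_nonneg fun i _ => hnonneg i _)]
      exact Finset.prod_le_prod (fun i _ => hnonneg i _) fun i _ => hC i _
    · simp only [hxy a (Finset.mem_singleton_self a)]

/-- If `ξ 0, …, ξ (n-1)` are bounded, negatively associated real random variables and
`ξ = ξ 0 + … + ξ (n-1)`, then for every real `α` and every `λ > 0`,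
`P(ξ > α) ≤ e^{-λα}·E[e^{λξ}] ≤ e^{-λα}·∏ᵢ E[e^{λ ξᵢ}]`. -/
theorem stmt7 {Ω : Type*} [MeasurableSpace Ω] (μ : Measure Ω) [IsProbabilityMeasure μ]
    {n : ℕ} (ξ : Fin n → Ω → ℝ)
    (hmeas : ∀ i, Measurable (ξ i))
    (hbdd : ∀ i, ∃ C, ∀ ω, |ξ i ω| ≤ C)
    (hNA : NegAssoc μ ξ)
    (α lam : ℝ) (hlam : 0 < lam) :
    (μ {ω | α < ∑ i, ξ i ω}).toReal ≤
        Real.exp (-(lam * α)) * ∫ ω, Real.exp (lam * ∑ i, ξ i ω) ∂μ ∧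
      Real.exp (-(lam * α)) * ∫ ω, Real.exp (lam * ∑ i, ξ i ω) ∂μ ≤
        Real.exp (-(lam * α)) * ∏ i, ∫ ω, Real.exp (lam * ξ i ω) ∂μ := by
  choose C hC using hbdd
  refine ⟨?_, mul_le_mul_of_nonneg_left ?_ (Real.exp_pos _).le⟩
  · have hsum : ∀ ω, ∑ i, ξ i ω ≤ ∑ i, C i := fun ω =>
      Finset.sum_le_sum fun i _ => (le_abs_self _).trans (hC i ω)
    have hint : Integrable (fun ω => Real.exp (lam * ∑ i, ξ i ω)) μ := by
      refine Integrable.of_bound (C := Real.exp (lam * ∑ i, C i))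
        (by fun_prop) (ae_of_all _ fun ω => ?_)
      rw [Real.norm_eq_abs, Real.abs_exp, Real.exp_le_exp]
      exact mul_le_mul_of_nonneg_left (hsum ω) hlam.le
    have hmarkov := ProbabilityTheory.measure_ge_le_exp_mul_mgf
      (X := fun ω => ∑ i, ξ i ω) α hlam.le hint
    rw [neg_mul] at hmarkov
    exact (measureReal_mono fun ω (hω : α < _) => hω.le).trans hmarkov
  · have hmin : ∀ i ω, min (ξ i ω) (C i) = ξ i ω := fun i ω =>
      min_eq_left ((le_abs_self _).trans (hC i ω))
    have hprod := hNA.integral_prod_le (h := fun i x => Real.exp (lam * min x (C i)))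
      (fun i x y hxy => Real.exp_le_exp.2
        (mul_le_mul_of_nonneg_left (min_le_min_right _ hxy) hlam.le))
      (fun i x => (Real.exp_pos _).le)
      (fun i => ⟨Real.exp (lam * C i), fun x => Real.exp_le_exp.2
        (mul_le_mul_of_nonneg_left (min_le_right _ _) hlam.le)⟩) Finset.univ
    simpa only [hmin, ← Real.exp_sum, ← Finset.mul_sum] using hprod
end

section
/- Let 𝒢 be a nearly-disjoint l-uniform hypergraph on n vertices and let δ > 0. Then |{e ∈ 𝒢 : I(e,𝒢) < δ·|𝒢|·l²/n}| < δ·|𝒢| + n/l. -/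
/-- The Cauchy-Schwarz inequality for the degrees of a uniform hypergraph: the pairwise intersection
sizes sum to at least `(l * |H|)² / n`. -/
lemma sq_mul_card_le_mul_sum_card_inter (n l : ℕ) (H : Finset (Finset (Fin n)))
    (hunif : ∀ e ∈ H, e.card = l) :
    ((l : ℝ) * H.card) ^ 2 ≤ n * ∑ e ∈ H, ∑ g ∈ H, ((e ∩ g).card : ℝ) := by
  have hdeg : ∑ v : Fin n, ∑ e ∈ H, (if v ∈ e then (1 : ℝ) else 0) = l * H.card := by
    rw [Finset.sum_comm, Finset.sum_congr rfl (g := fun _ => (l : ℝ))]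
    · simp [mul_comm]
    · intro e he
      simp [hunif e he]
  have hsq : ∑ e ∈ H, ∑ g ∈ H, ((e ∩ g).card : ℝ) =
      ∑ v : Fin n, (∑ e ∈ H, (if v ∈ e then (1 : ℝ) else 0)) ^ 2 := by
    have hinter : ∀ e g : Finset (Fin n), ((e ∩ g).card : ℝ) =
        ∑ v : Fin n, (if v ∈ e then (1 : ℝ) else 0) * (if v ∈ g then (1 : ℝ) else 0) := by
      intro e g
      have hind : ∀ v : Fin n, (if v ∈ e then (1 : ℝ) else 0) * (if v ∈ g then (1 : ℝ) else 0) =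
          if v ∈ e ∩ g then 1 else 0 := fun v => by
        by_cases hv : v ∈ e <;> simp [hv]
      simp_rw [hind]
      simp only [Finset.sum_boole, Finset.filter_univ_mem]
    simp_rw [hinter, sq, Finset.sum_mul_sum]
    rw [Finset.sum_comm (s := Finset.univ)]
    refine Finset.sum_congr rfl fun e _ => ?_
    rw [Finset.sum_comm]
  rw [← hdeg, hsq]
  simpa using sq_sum_le_card_mul_sum_sq (s := (Finset.univ : Finset (Fin n)))
    (f := fun v => ∑ e ∈ H, (if v ∈ e then (1 : ℝ) else 0))

/-- In a nearly-disjoint uniform hypergraph, the intersection sizes with an edge `e` sum to at most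
the number of edges meeting `e`, plus `l - 1`. -/
lemma sum_card_inter_le_card_filter (n l : ℕ) (hl : 0 < l) (H : Finset (Finset (Fin n)))
    (hunif : ∀ e ∈ H, e.card = l)
    (hnd : ∀ e ∈ H, ∀ f ∈ H, e ≠ f → (e ∩ f).card ≤ 1) (e : Finset (Fin n)) (he : e ∈ H) :
    ∑ g ∈ H, ((e ∩ g).card : ℝ) ≤
      ((H.filter fun g => (e ∩ g).Nonempty).card : ℝ) + (l - 1) := by
  have hterm : ∀ g ∈ H, ((e ∩ g).card : ℝ) ≤
      (if (e ∩ g).Nonempty then 1 else 0) + (if e = g then (l : ℝ) - 1 else 0) := by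
    intro g hg
    by_cases heg : e = g
    · subst heg
      have : e.Nonempty := Finset.card_pos.mp (by rw [hunif e he]; exact hl)
      simp [this, hunif e he]
    · by_cases hne : (e ∩ g).Nonempty
      · simpa [heg, hne] using hnd e he g hg heg
      · simp [heg, Finset.not_nonempty_iff_eq_empty.mp hne]
  refine (Finset.sum_le_sum hterm).trans_eq ?_
  rw [Finset.sum_add_distrib]
  simp [he]

/-- Let `G` be a nearly-disjoint `l`-uniform hypergraph on `n` vertices and `δ > 0`.
Writing `I(e,G) = |{g ∈ G : e ∩ g ≠ ∅}|`, the number of edges `e ∈ G` with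
`I(e,G) < δ·|G|·l²/n` is less than `δ·|G| + n/l`. -/
theorem stmt8 (n l : ℕ) (hn : 0 < n) (hl : 0 < l) (G : Finset (Finset (Fin n)))
    (hunif : ∀ e ∈ G, e.card = l)
    (hnd : ∀ e ∈ G, ∀ f ∈ G, e ≠ f → (e ∩ f).card ≤ 1)
    (δ : ℝ) (hδ : 0 < δ) :
    (({e : Finset (Fin n) | e ∈ G ∧
          ((G.filter fun g => (e ∩ g).Nonempty).card : ℝ) <
            δ * (G.card : ℝ) * (l : ℝ) ^ 2 / (n : ℝ)}).ncard : ℝ) <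
      δ * (G.card : ℝ) + (n : ℝ) / (l : ℝ) := by
  classical
  set c : ℝ := δ * (G.card : ℝ) * (l : ℝ) ^ 2 / (n : ℝ) with hc
  set H : Finset (Finset (Fin n)) :=
    G.filter fun e => ((G.filter fun g => (e ∩ g).Nonempty).card : ℝ) < c with hH
  have hset : {e : Finset (Fin n) | e ∈ G ∧
      ((G.filter fun g => (e ∩ g).Nonempty).card : ℝ) < c} = (H : Set (Finset (Fin n))) := by
    ext e
    simp [hH]
  rw [hset, Set.ncard_coe_finset]
  have hn' : (0 : ℝ) < n := by exact_mod_cast hn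
  have hl' : (0 : ℝ) < l := by exact_mod_cast hl
  rcases H.eq_empty_or_nonempty with hempty | hne
  · rw [hempty, Finset.card_empty, Nat.cast_zero]
    positivity
  have hHG : H ⊆ G := Finset.filter_subset _ _
  have hm : (0 : ℝ) < H.card := by exact_mod_cast hne.card_pos
  have hlower := sq_mul_card_le_mul_sum_card_inter n l H fun e he => hunif e (hHG he)
  have hupper : ∑ e ∈ H, ∑ g ∈ H, ((e ∩ g).card : ℝ) ≤ H.card * (c + (l - 1)) := by
    rw [← nsmul_eq_mul]
    refine Finset.sum_le_card_nsmul _ _ _ fun e he => ?_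
    have hsum := sum_card_inter_le_card_filter n l hl H (fun e he => hunif e (hHG he))
      (fun e he f hf => hnd e (hHG he) f (hHG hf)) e he
    have hmono : ((H.filter fun g => (e ∩ g).Nonempty).card : ℝ) ≤
        (G.filter fun g => (e ∩ g).Nonempty).card := by
      exact_mod_cast Finset.card_le_card (Finset.filter_subset_filter _ hHG)
    have hlt := (Finset.mem_filter.mp he).2
    linarith
  have hcn : n * c = δ * G.card * l ^ 2 := by
    rw [hc]
    field_simp
  have hmul : (H.card : ℝ) * (l ^ 2 * H.card) ≤ H.card * (δ * G.card * l ^ 2 + n * (l - 1)) := by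
    calc (H.card : ℝ) * (l ^ 2 * H.card) = (l * H.card) ^ 2 := by ring
      _ ≤ n * (H.card * (c + (l - 1))) := hlower.trans (by gcongr)
      _ = H.card * (n * c + n * (l - 1)) := by ring
      _ = _ := by rw [hcn]
  have hdiv := le_of_mul_le_mul_left hmul hm
  refine lt_of_mul_lt_mul_left (a := (l : ℝ) ^ 2) ?_ (by positivity)
  have hexpand : (l : ℝ) ^ 2 * (δ * G.card + n / l) = δ * G.card * l ^ 2 + n * l := by
    field_simp
  rw [hexpand]
  linarith
end

section
/- There is a constant c > 0 such that for all sufficiently large n the following holds, where k = k₀(n) − 4 and M = f_n(k). Every (finite simple) graph Γ with M/2 ≤ |V(Γ)| ≤ 2M, fewer than k⁴M²/n² edges, and fewer than 2k⁶M³/n⁴ triangles has an independent set of size at least c·n²·(log k)/k⁴. -/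
/-- `fExp n k` is the expected number of `k`-cliques in `G_{n,1/2}`,
i.e. `C(n,k) · 2^{-C(k,2)}`. -/
noncomputable def fExp (n k : ℕ) : ℝ := (n.choose k : ℝ) / 2 ^ (k.choose 2)

/-- `kZero n = min {k : fExp n k < 1}`. -/
noncomputable def kZero (n : ℕ) : ℕ := sInf {k | fExp n k < 1}

namespace SimpleGraph

open Finset

section

variable {V : Type*} (G : SimpleGraph V) [DecidableRel G.Adj]

/-- The independent sets of `G` contained in `U`. -/
def indepSubsets (U : Finset V) : Finset (Finset V) :=
  U.powerset.filter fun I => ∀ a ∈ I, ∀ b ∈ I, ¬ G.Adj a b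

variable {G} in
theorem mem_indepSubsets {U I : Finset V} :
    I ∈ G.indepSubsets U ↔ I ⊆ U ∧ ∀ a ∈ I, ∀ b ∈ I, ¬ G.Adj a b := by
  simp [indepSubsets]

theorem empty_mem_indepSubsets (U : Finset V) : ∅ ∈ G.indepSubsets U := by
  simp [mem_indepSubsets]

/-- The partition function of the hard-core model on `U`. -/
def hardCoreSum (U : Finset V) (l : ℝ) : ℝ := ∑ I ∈ G.indepSubsets U, l ^ #I

theorem hardCoreSum_pos (U : Finset V) {l : ℝ} (hl : 0 < l) : 0 < G.hardCoreSum U l :=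
  sum_pos (fun _ _ => by positivity) ⟨∅, G.empty_mem_indepSubsets U⟩

theorem hardCoreSum_le_exp (U : Finset V) {l : ℝ} (hl : 0 < l) :
    G.hardCoreSum U l ≤ Real.exp (l * #U) := by
  calc G.hardCoreSum U l ≤ ∑ I ∈ U.powerset, l ^ #I :=
        sum_le_sum_of_subset_of_nonneg (filter_subset _ _) fun _ _ _ => by positivity
    _ = (l + 1) ^ #U := by
        rw [← sum_pow_mul_eq_add_pow]; simp
    _ ≤ Real.exp l ^ #U := by gcongr; exact Real.add_one_le_exp l
    _ = _ := by rw [← Real.exp_nat_mul, mul_comm]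

variable [DecidableEq V]

/-- A given vertex is occupied with probability at most `l`. -/
theorem sum_indepSubsets_mem_le (U : Finset V) {l : ℝ} (hl : 0 < l) (w : V) :
    ∑ I ∈ G.indepSubsets U with w ∈ I, l ^ #I ≤ l * G.hardCoreSum U l := by
  have h : ∑ I ∈ G.indepSubsets U with w ∈ I, l ^ #I =
      l * ∑ I ∈ (G.indepSubsets U).filter (w ∈ ·), l ^ #(I.erase w) := by
    rw [mul_sum]
    refine sum_congr rfl fun I hI => ?_
    rw [← card_erase_add_one (mem_filter.1 hI).2, pow_succ']
  rw [h, ← sum_image (f := fun I => l ^ #I) (g := fun I : Finset V => I.erase w)]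
  · refine mul_le_mul_of_nonneg_left ?_ hl.le
    refine sum_le_sum_of_subset_of_nonneg ?_ fun _ _ _ => by positivity
    intro T hT
    obtain ⟨I, hI, rfl⟩ := mem_image.1 hT
    have := mem_indepSubsets.1 (mem_filter.1 hI).1
    exact mem_indepSubsets.2 ⟨(erase_subset _ _).trans this.1, fun a ha b hb =>
      this.2 a (mem_of_mem_erase ha) b (mem_of_mem_erase hb)⟩
  · intro I hI K hK h
    rw [← insert_erase (mem_filter.1 (mem_coe.1 hI)).2,
      ← insert_erase (mem_filter.1 (mem_coe.1 hK)).2]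
    exact congrArg (insert w) h

theorem le_sum_indepSubsets_mem (U : Finset V) {l : ℝ} (hl : 0 < l) {u : V} (hu : u ∈ U) :
    l * (1 - l * (1 + #(U.filter (G.Adj u)))) * G.hardCoreSum U l ≤
      ∑ I ∈ G.indepSubsets U with u ∈ I, l ^ #I := by
  set B := insert u (U.filter (G.Adj u)) with hB
  have hcard : #B = 1 + #(U.filter (G.Adj u)) := by
    rw [hB, card_insert_of_notMem (by simp), add_comm]
  set F := (G.indepSubsets U).filter fun I => Disjoint I B with hF
  have h1 : l * ∑ I ∈ F, l ^ #I ≤ ∑ I ∈ G.indepSubsets U with u ∈ I, l ^ #I := by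
    have h : l * ∑ I ∈ F, l ^ #I = ∑ I ∈ F, l ^ #(insert u I) := by
      rw [mul_sum]
      refine sum_congr rfl fun I hI => ?_
      have : u ∉ I := fun h => Finset.disjoint_left.1 (mem_filter.1 hI).2 h (mem_insert_self _ _)
      rw [card_insert_of_notMem this, pow_succ']
    rw [h, ← sum_image (f := fun I => l ^ #I) (g := fun I : Finset V => insert u I)]
    · refine sum_le_sum_of_subset_of_nonneg ?_ fun _ _ _ => by positivity
      intro T hT
      obtain ⟨I, hI, rfl⟩ := mem_image.1 hT
      obtain ⟨hI, hd⟩ := mem_filter.1 hI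
      obtain ⟨hIU, hi⟩ := mem_indepSubsets.1 hI
      have hna : ∀ a ∈ I, ¬ G.Adj u a := fun a ha h => Finset.disjoint_left.1 hd ha
        (mem_insert_of_mem (mem_filter.2 ⟨hIU ha, h⟩))
      refine mem_filter.2 ⟨mem_indepSubsets.2 ⟨insert_subset hu hIU, ?_⟩, mem_insert_self _ _⟩
      intro a ha b hb
      rcases mem_insert.1 ha with rfl | ha₁ <;> rcases mem_insert.1 hb with rfl | hb₁
      · exact G.loopless.irrefl _
      · exact hna b hb₁
      · exact fun h => hna a ha₁ h.symm
      · exact hi a ha₁ b hb₁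
    · intro I hI K hK h
      have h1 : ∀ I ∈ F, u ∉ I := fun I hI h =>
        Finset.disjoint_left.1 (mem_filter.1 hI).2 h (mem_insert_self _ _)
      rw [← erase_insert (h1 I hI), ← erase_insert (h1 K hK)]
      exact congrArg (fun s => erase s u) h
  have h2 : G.hardCoreSum U l - ∑ w ∈ B, l * G.hardCoreSum U l ≤ ∑ I ∈ F, l ^ #I := by
    have h3 : ∑ w ∈ B, ∑ I ∈ G.indepSubsets U with w ∈ I, l ^ #I ≤
        ∑ w ∈ B, l * G.hardCoreSum U l :=
      sum_le_sum fun w _ => G.sum_indepSubsets_mem_le U hl w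
    have h4 : ∑ I ∈ (G.indepSubsets U).filter (fun I => ¬ Disjoint I B), l ^ #I ≤
        ∑ w ∈ B, ∑ I ∈ G.indepSubsets U with w ∈ I, l ^ #I := by
      simp_rw [sum_filter]
      rw [sum_comm]
      refine sum_le_sum fun I _ => ?_
      have h0 : ∀ w, 0 ≤ if w ∈ I then l ^ #I else 0 := fun w => by split_ifs <;> positivity
      split_ifs with h
      · exact sum_nonneg fun w _ => h0 w
      · obtain ⟨w, hw, hwB⟩ := Finset.not_disjoint_iff.1 h
        exact le_trans (by rw [if_pos hw]) (single_le_sum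
          (f := fun w => if w ∈ I then l ^ #I else 0) (fun w _ => h0 w) hwB)
    have h5 := sum_filter_add_sum_filter_not (G.indepSubsets U) (fun I => Disjoint I B)
      (fun I => l ^ #I)
    rw [hardCoreSum] at *
    linarith
  refine le_trans (le_of_eq ?_) ((mul_le_mul_of_nonneg_left h2 hl.le).trans h1)
  rw [sum_const, hcard]
  simp only [nsmul_eq_mul]
  push_cast
  ring

/-- Lower bound for the expected size of a hard-core random independent set. -/
theorem le_sum_indepSubsets_card (U : Finset V) {l : ℝ} (hl : 0 < l) :
    (l * (1 - l) * #U - l ^ 2 * ∑ u ∈ U, (#(U.filter (G.Adj u)) : ℝ)) * G.hardCoreSum U l ≤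
      ∑ I ∈ G.indepSubsets U, l ^ #I * (#I : ℝ) := by
  have h : ∑ I ∈ G.indepSubsets U, l ^ #I * (#I : ℝ) =
      ∑ u ∈ U, ∑ I ∈ G.indepSubsets U with u ∈ I, l ^ #I := by
    simp_rw [sum_filter]
    rw [sum_comm]
    refine sum_congr rfl fun I hI => ?_
    rw [← sum_filter, sum_const, filter_mem_eq_inter,
      inter_eq_right.2 (mem_indepSubsets.1 hI).1, nsmul_eq_mul, mul_comm]
  rw [h]
  refine le_trans (le_of_eq ?_) (sum_le_sum fun u hu => G.le_sum_indepSubsets_mem U hl hu)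
  rw [← sum_mul, ← mul_sum, sum_sub_distrib, ← mul_sum, sum_add_distrib]
  simp only [sum_const, nsmul_eq_mul]
  ring

variable {G} in
/-- Conditioning a random independent set on its part `J` outside the closed neighbourhood of `v`:
either `v` is added to `J`, or an independent set of neighbours of `v` not adjacent to `J`. -/
theorem sum_indepSubsets_fiber {U J : Finset V} {v : V} (hv : v ∈ U)
    (hJ : J ∈ G.indepSubsets U) (hvJ : Disjoint J (insert v (U.filter (G.Adj v))))
    (f : Finset V → ℝ) :
    ∑ I ∈ G.indepSubsets U with I \ insert v (U.filter (G.Adj v)) = J, f I =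
      f (insert v J) + ∑ T ∈ G.indepSubsets
        ((U.filter (G.Adj v)).filter fun u => ∀ a ∈ J, ¬ G.Adj u a), f (J ∪ T) := by
  obtain ⟨hJU, hJi⟩ := mem_indepSubsets.1 hJ
  set N := U.filter (G.Adj v) with hN
  set X := N.filter fun u => ∀ a ∈ J, ¬ G.Adj u a with hX
  have hvN : v ∉ N := by simp [hN]
  have hvJ' : v ∉ J := fun h => Finset.disjoint_left.1 hvJ h (mem_insert_self _ _)
  have hJN : ∀ a ∈ J, a ∉ N := fun a ha h =>
    Finset.disjoint_left.1 hvJ ha (mem_insert_of_mem h)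
  have hJT : ∀ T ∈ G.indepSubsets X, Disjoint J T := fun T hT =>
    Finset.disjoint_left.2 fun a ha h =>
      hJN a ha (mem_filter.1 ((mem_indepSubsets.1 hT).1 h)).1
  have hinj : Set.InjOn (fun T => J ∪ T) (G.indepSubsets X : Set (Finset V)) := by
    intro T hT T' hT' h
    dsimp only at h
    rw [← union_sdiff_cancel_left (hJT T hT), h, union_sdiff_cancel_left (hJT T' hT')]
  have hnot : insert v J ∉ (G.indepSubsets X).image fun T => J ∪ T := by
    intro h
    obtain ⟨T, hT, h⟩ := mem_image.1 h
    have : v ∈ J ∪ T := h ▸ mem_insert_self v J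
    rcases mem_union.1 this with h | h
    · exact hvJ' h
    · exact hvN (mem_filter.1 ((mem_indepSubsets.1 hT).1 h)).1
  rw [← sum_image hinj, ← sum_insert hnot]
  congr 1
  ext I
  simp only [mem_filter, mem_insert, mem_image, mem_indepSubsets]
  constructor
  · rintro ⟨⟨hIU, hi⟩, rfl⟩
    by_cases hvI : v ∈ I
    · left
      ext a
      simp only [mem_insert, mem_sdiff, hN, mem_filter]
      have := hi v hvI a
      grind
    · right
      refine ⟨I ∩ N, ⟨fun a ha => ?_, fun a ha b hb => ?_⟩, ?_⟩
      · rw [mem_inter] at ha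
        exact mem_filter.2 ⟨ha.2, fun b hb => hi a ha.1 b (mem_sdiff.1 hb).1⟩
      · exact hi a (mem_inter.1 ha).1 b (mem_inter.1 hb).1
      · ext a
        simp only [mem_union, mem_sdiff, mem_insert, mem_inter]
        grind
  · rintro (rfl | ⟨T, ⟨hTX, hTi⟩, rfl⟩)
    · refine ⟨⟨insert_subset hv hJU, ?_⟩, ?_⟩
      · have h : ∀ a ∈ J, ¬ G.Adj v a := fun a ha h => hJN a ha (mem_filter.2 ⟨hJU ha, h⟩)
        intro a ha b hb
        rcases mem_insert.1 ha with rfl | ha₁ <;> rcases mem_insert.1 hb with rfl | hb₁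
        · exact G.loopless.irrefl _
        · exact h b hb₁
        · exact fun h' => h a ha₁ h'.symm
        · exact hJi a ha₁ b hb₁
      · ext a
        simp only [mem_sdiff, mem_insert]
        grind
    · refine ⟨⟨union_subset hJU fun a ha => ?_, ?_⟩, ?_⟩
      · exact (mem_filter.1 (mem_filter.1 (hTX ha)).1).1
      · intro a ha b hb
        rcases mem_union.1 ha with ha | ha <;> rcases mem_union.1 hb with hb | hb
        · exact hJi a ha b hb
        · exact fun h => (mem_filter.1 (hTX hb)).2 a ha h.symm
        · exact (mem_filter.1 (hTX ha)).2 b hb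
        · exact hTi a ha b hb
      · have hTN : ∀ a ∈ T, a ∈ N := fun a ha => (mem_filter.1 (hTX ha)).1
        ext a
        simp only [mem_sdiff, mem_insert, mem_union]
        grind

/-- Local occupancy estimate: if few edges lie inside the neighbourhood of `v`, then `v` or many of
its neighbours are likely to be occupied. -/
theorem le_sum_indepSubsets_local {U : Finset V} {v : V} (hv : v ∈ U) {l A Q : ℝ} (hl : 0 < l)
    (hl2 : l ≤ 1 / 2) (hQ : 0 ≤ Q) (hQA : 2 * Q ≤ A)
    (ht : l ^ 2 * ∑ u ∈ U with G.Adj v u, (#((U.filter (G.Adj v)).filter (G.Adj u)) : ℝ) ≤ 1)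
    (hA : 2 * (Q * Real.exp (2 * Q + 2)) ≤ l * A) :
    Q * G.hardCoreSum U l ≤ ∑ I ∈ G.indepSubsets U,
      l ^ #I * ((if v ∈ I then A else 0) + #(I ∩ U.filter (G.Adj v))) := by
  set N := U.filter (G.Adj v) with hN
  rw [← sub_nonneg, hardCoreSum, mul_sum, ← sum_sub_distrib]
  rw [← sum_fiberwise_of_maps_to
    (g := fun I => I \ insert v N) (fun I hI => mem_image_of_mem _ hI)]
  refine sum_nonneg fun J hJ => ?_
  obtain ⟨K, hK, rfl⟩ := mem_image.1 hJ
  have hK' := mem_indepSubsets.1 hK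
  have hJ' : K \ insert v N ∈ G.indepSubsets U :=
    mem_indepSubsets.2 ⟨sdiff_subset.trans hK'.1, fun a ha b hb =>
      hK'.2 a (sdiff_subset ha) b (sdiff_subset hb)⟩
  have hdisj : Disjoint (K \ insert v N) (insert v N) := sdiff_disjoint
  rw [sum_indepSubsets_fiber hv hJ' hdisj]
  generalize K \ insert v N = J at hdisj
  set X := N.filter fun u => ∀ a ∈ J, ¬ G.Adj u a with hX
  have hvN : v ∉ N := by simp [hN]
  have hvJ : v ∉ J := fun h => Finset.disjoint_left.1 hdisj h (mem_insert_self _ _)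
  have hJN : Disjoint J N := disjoint_of_subset_right (subset_insert _ _) hdisj
  have e1 : insert v J ∩ N = ∅ := by
    rw [insert_inter_of_notMem hvN]; exact disjoint_iff_inter_eq_empty.1 hJN
  have e2 : ∀ T ∈ G.indepSubsets X,
      l ^ #(J ∪ T) * ((if v ∈ J ∪ T then A else 0) + #((J ∪ T) ∩ N)) - Q * l ^ #(J ∪ T) =
        l ^ #J * (l ^ #T * (#T : ℝ) - Q * l ^ #T) := by
    intro T hT
    have hTN : T ⊆ N := (mem_indepSubsets.1 hT).1.trans (filter_subset _ _)
    rw [union_inter_distrib_right, disjoint_iff_inter_eq_empty.1 hJN, empty_union,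
      inter_eq_left.2 hTN, if_neg (by
        rw [mem_union]; exact fun h => h.elim hvJ fun h => hvN (hTN h)),
      card_union_of_disjoint (disjoint_of_subset_right hTN hJN), pow_add]
    ring
  rw [sum_congr rfl e2, ← mul_sum, sum_sub_distrib, ← mul_sum, e1,
    card_insert_of_notMem hvJ, if_pos (mem_insert_self _ _), pow_succ, card_empty]
  have h1 := G.le_sum_indepSubsets_card X hl
  have h2 := G.hardCoreSum_le_exp X hl
  have h3 := G.hardCoreSum_pos X hl
  have h4 : (∑ u ∈ X, (#(X.filter (G.Adj u)) : ℝ)) ≤ ∑ u ∈ N, (#(N.filter (G.Adj u)) : ℝ) := by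
    have hXN : X ⊆ N := filter_subset _ _
    refine (sum_le_sum fun u _ => ?_).trans
      (sum_le_sum_of_subset_of_nonneg hXN fun _ _ _ => by positivity)
    exact_mod_cast card_le_card (filter_subset_filter _ hXN)
  have h5 := (mul_le_mul_of_nonneg_left h4 (sq_nonneg l)).trans ht
  have h6 : l * #X / 2 ≤ l * (1 - l) * #X := by
    have : 0 ≤ l * (#X : ℝ) := by positivity
    nlinarith
  rw [← hardCoreSum]
  set Z := G.hardCoreSum X l
  have h7 : (l * #X / 2 - 1) * Z ≤ ∑ I ∈ G.indepSubsets X, l ^ #I * (#I : ℝ) :=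
    le_trans (mul_le_mul_of_nonneg_right (by linarith) h3.le) h1
  have h8 : 0 ≤ l * (A - Q) + (∑ I ∈ G.indepSubsets X, l ^ #I * (#I : ℝ) - Q * Z) := by
    rcases le_total Q (l * #X / 2 - 1) with h | h
    · have := mul_le_mul_of_nonneg_right h h3.le
      have : 0 ≤ l * (A - Q) := mul_nonneg hl.le (by linarith)
      linarith
    · have h9 : Z ≤ Real.exp (2 * Q + 2) := h2.trans (Real.exp_le_exp.2 (by linarith))
      have h10 := mul_le_mul_of_nonneg_left h9 hQ
      have h11 : 0 ≤ ∑ I ∈ G.indepSubsets X, l ^ #I * (#I : ℝ) :=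
        sum_nonneg fun _ _ => by positivity
      have h12 : l * (2 * Q) ≤ l * A := mul_le_mul_of_nonneg_left hQA hl.le
      linarith
  have h9 := mul_nonneg (pow_pos hl #J).le h8
  push_cast
  linarith

/-- A locally sparse graph of maximum degree at most `A` has an independent set of size at least
`#U * Q / (2 * A)`, where `Q` is of the order of the logarithm of `l * A`. -/
theorem exists_mem_indepSubsets_card {U : Finset V} {l A Q : ℝ} (hl : 0 < l)
    (hl2 : l ≤ 1 / 2) (hQ : 0 ≤ Q) (hQA : 2 * Q ≤ A)
    (hdeg : ∀ v ∈ U, (#(U.filter (G.Adj v)) : ℝ) ≤ A)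
    (ht : ∀ v ∈ U,
      l ^ 2 * ∑ u ∈ U with G.Adj v u, (#((U.filter (G.Adj v)).filter (G.Adj u)) : ℝ) ≤ 1)
    (hA : 2 * (Q * Real.exp (2 * Q + 2)) ≤ l * A) :
    ∃ I ∈ G.indepSubsets U, #U * Q ≤ 2 * A * #I := by
  by_contra! hcon
  have h1 := sum_le_sum fun v hv => G.le_sum_indepSubsets_local hv hl hl2 hQ hQA (ht v hv) hA
  rw [sum_comm, sum_const, nsmul_eq_mul, hardCoreSum, mul_sum, mul_sum] at h1
  refine absurd h1 (not_le.2 (sum_lt_sum_of_nonempty ⟨∅, G.empty_mem_indepSubsets U⟩ ?_))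
  intro I hI
  have hIU := (mem_indepSubsets.1 hI).1
  have e1 : ∑ v ∈ U, (if v ∈ I then A else 0) = A * #I := by
    rw [← sum_filter, sum_const, filter_mem_eq_inter, inter_eq_right.2 hIU, nsmul_eq_mul, mul_comm]
  have e2 : ∑ v ∈ U, (#(I ∩ U.filter (G.Adj v)) : ℝ) ≤ A * #I := by
    have : ∑ v ∈ U, (#(I ∩ U.filter (G.Adj v)) : ℝ) = ∑ u ∈ I, (#(U.filter (G.Adj u)) : ℝ) := by
      have h : ∀ v ∈ U, (#(I ∩ U.filter (G.Adj v)) : ℝ) =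
          ∑ u ∈ I, if G.Adj v u then (1 : ℝ) else 0 := fun v _ => by
        rw [sum_boole, inter_filter, inter_eq_left.2 hIU]
      rw [sum_congr rfl h, sum_comm]
      refine sum_congr rfl fun u _ => ?_
      rw [sum_boole]
      simp only [G.adj_comm]
    rw [this, mul_comm, ← nsmul_eq_mul, ← sum_const]
    exact sum_le_sum fun u hu => hdeg u (hIU hu)
  rw [← mul_sum, sum_add_distrib, e1]
  have := hcon I hI
  have hp := pow_pos hl #I
  nlinarith

end

theorem mul_card_filter_lt_le_sum {V : Type*} [Fintype V] (f : V → ℕ) (a : ℝ) :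
    a * #(univ.filter fun v => a < f v) ≤ ((∑ v, f v : ℕ) : ℝ) := by
  push_cast
  calc a * #(univ.filter fun v => a < f v) = ∑ v with a < f v, a := by
        rw [sum_const, nsmul_eq_mul, mul_comm]
    _ ≤ ∑ v with a < f v, (f v : ℝ) := sum_le_sum fun v hv => (mem_filter.1 hv).2.le
    _ ≤ _ := sum_le_sum_of_subset_of_nonneg (filter_subset _ _) fun _ _ _ => by positivity

variable {V : Type*} [Fintype V] [DecidableEq V] (G : SimpleGraph V) [DecidableRel G.Adj]

/-- Each triangle is counted by a bounded number of ordered triples. -/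
theorem sum_card_adj_adj_le :
    ∑ v, ∑ u ∈ univ with G.Adj v u, #((univ.filter (G.Adj v)).filter (G.Adj u)) ≤
      27 * #(G.cliqueFinset 3) := by
  set S : Finset (V × V × V) := univ.filter fun p =>
    G.Adj p.1 p.2.1 ∧ G.Adj p.1 p.2.2 ∧ G.Adj p.2.1 p.2.2 with hS
  have h1 : ∑ v, ∑ u ∈ univ with G.Adj v u, #((univ.filter (G.Adj v)).filter (G.Adj u)) = #S := by
    rw [hS, card_filter, Fintype.sum_prod_type]
    refine sum_congr rfl fun v _ => ?_
    rw [Fintype.sum_prod_type, sum_filter]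
    refine sum_congr rfl fun u _ => ?_
    rw [filter_filter, card_filter]
    split_ifs with h <;> simp [h]
  rw [h1]
  refine card_le_mul_card_image_of_maps_to
    (f := fun p : V × V × V => ({p.1, p.2.1, p.2.2} : Finset V)) (fun p hp => ?_) 27 fun s hs => ?_
  · rw [mem_cliqueFinset_iff, is3Clique_iff]
    exact ⟨p.1, p.2.1, p.2.2, (mem_filter.1 hp).2.1, (mem_filter.1 hp).2.2.1,
      (mem_filter.1 hp).2.2.2, rfl⟩
  · have hs3 : #s = 3 := (mem_cliqueFinset_iff.1 hs).card_eq
    calc _ ≤ #(s ×ˢ s ×ˢ s) := card_le_card fun p hp => by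
          have := (mem_filter.1 hp).2
          subst this
          simp
      _ = 27 := by simp [card_product, hs3]

/-- A graph with few edges and triangles has a large set of vertices of small degree which lie in
few triangles. -/
theorem exists_large_locally_sparse {A t : ℝ} (hA : 0 < A) (ht : 0 < t)
    (hE : 8 * (#G.edgeFinset : ℝ) ≤ A * Fintype.card V)
    (hT : 108 * (#(G.cliqueFinset 3) : ℝ) ≤ t * Fintype.card V) :
    ∃ U : Finset V, (Fintype.card V : ℝ) / 2 ≤ #U ∧
      (∀ v ∈ U, (#(U.filter (G.Adj v)) : ℝ) ≤ A) ∧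
      ∀ v ∈ U, ∑ u ∈ U with G.Adj v u,
        (#((U.filter (G.Adj v)).filter (G.Adj u)) : ℝ) ≤ t := by
  set d : V → ℕ := fun v => G.degree v with hd
  set q : V → ℕ := fun v =>
    ∑ u ∈ univ with G.Adj v u, #((univ.filter (G.Adj v)).filter (G.Adj u)) with hq
  have h1 := mul_card_filter_lt_le_sum d A
  have h2 := mul_card_filter_lt_le_sum q t
  rw [show ∑ v, d v = _ from G.sum_degrees_eq_twice_card_edges] at h1
  have h3 : ((∑ v, q v : ℕ) : ℝ) ≤ 27 * (#(G.cliqueFinset 3) : ℝ) := by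
    exact_mod_cast G.sum_card_adj_adj_le
  push_cast at h1
  have h4 : (#(univ.filter fun v => A < d v) : ℝ) ≤ Fintype.card V / 4 :=
    le_of_mul_le_mul_left (by linarith) hA
  have h5 : (#(univ.filter fun v => t < q v) : ℝ) ≤ Fintype.card V / 4 :=
    le_of_mul_le_mul_left (by linarith) ht
  refine ⟨univ.filter fun v => (d v : ℝ) ≤ A ∧ (q v : ℝ) ≤ t, ?_, fun v hv => ?_, fun v hv => ?_⟩
  · have h6 : (univ : Finset V) ⊆ (univ.filter fun v => (d v : ℝ) ≤ A ∧ (q v : ℝ) ≤ t) ∪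
        ((univ.filter fun v => A < d v) ∪ (univ.filter fun v => t < q v)) := by
      intro v _
      simp only [mem_union, mem_filter, mem_univ, true_and]
      by_cases h : (d v : ℝ) ≤ A
      · by_cases h' : (q v : ℝ) ≤ t
        · exact Or.inl ⟨h, h'⟩
        · exact Or.inr (Or.inr (not_le.1 h'))
      · exact Or.inr (Or.inl (not_le.1 h))
    have h7 := (card_le_card h6).trans
      ((card_union_le _ _).trans (Nat.add_le_add_left (card_union_le _ _) _))
    rw [card_univ] at h7
    have h8 : (Fintype.card V : ℝ) ≤ #(univ.filter fun v => (d v : ℝ) ≤ A ∧ (q v : ℝ) ≤ t) +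
        (#(univ.filter fun v => A < d v) + #(univ.filter fun v => t < q v)) := by
      exact_mod_cast h7
    linarith
  · refine le_trans ?_ (mem_filter.1 hv).2.1
    rw [Nat.cast_le, show d v = G.degree v from rfl, ← card_neighborFinset_eq_degree,
      neighborFinset_eq_filter]
    exact card_le_card (filter_subset_filter _ (subset_univ _))
  · refine le_trans ?_ (mem_filter.1 hv).2.2
    rw [← Nat.cast_sum, Nat.cast_le]
    refine (sum_le_sum fun u _ => card_le_card (filter_subset_filter _ (filter_subset_filter _
      (subset_univ _)))).trans (sum_le_sum_of_subset (filter_subset_filter _ (subset_univ _)))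

end SimpleGraph

theorem fExp_zero_right (n : ℕ) : fExp n 0 = 1 := by simp [fExp]

theorem one_le_fExp_iff {n j : ℕ} : 1 ≤ fExp n j ↔ 2 ^ j.choose 2 ≤ n.choose j := by
  rw [fExp, le_div_iff₀ (by positivity), one_mul]
  exact_mod_cast Iff.rfl

theorem two_pow_choose_two_sq (j : ℕ) : (2 ^ j.choose 2) ^ 2 = (2 ^ (j - 1)) ^ j := by
  rw [← pow_mul, ← pow_mul, Nat.choose_two_right,
    Nat.div_mul_cancel (Nat.even_mul_pred_self j).two_dvd, mul_comm]

theorem two_pow_le_sq_of_one_le_fExp {n j : ℕ} (hj : j ≠ 0) (h : 1 ≤ fExp n j) :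
    2 ^ (j - 1) ≤ n ^ 2 := by
  rw [one_le_fExp_iff] at h
  refine (Nat.pow_le_pow_iff_left hj).1 ?_
  rw [← two_pow_choose_two_sq, pow_right_comm n 2 j]
  exact Nat.pow_le_pow_left (h.trans (Nat.choose_le_pow n j)) 2

theorem sq_lt_of_fExp_lt_one {n j : ℕ} (h : fExp n j < 1) : n ^ 2 < 2 ^ (j - 1) * (4 * j ^ 2) := by
  have hj : j ≠ 0 := by
    rintro rfl
    simp [fExp_zero_right] at h
  rcases lt_or_ge n (2 * j) with hn | hn
  · have : n ^ 2 < (2 * j) ^ 2 := Nat.pow_lt_pow_left hn two_ne_zero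
    have := Nat.one_le_two_pow (n := j - 1)
    nlinarith
  · rw [← not_le, one_le_fExp_iff, not_le] at h
    have h1 : (n + 1 - j) ^ j ≤ j ^ j * n.choose j :=
      (Nat.pow_sub_le_descFactorial n j).trans
        (by rw [Nat.descFactorial_eq_factorial_mul_choose]
            exact Nat.mul_le_mul_right _ (Nat.factorial_le_pow j))
    have h2 : n ^ j ≤ (2 * j) ^ j * n.choose j := by
      calc n ^ j ≤ (2 * (n + 1 - j)) ^ j := Nat.pow_le_pow_left (by omega) j
        _ = 2 ^ j * (n + 1 - j) ^ j := mul_pow _ _ _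
        _ ≤ 2 ^ j * (j ^ j * n.choose j) := Nat.mul_le_mul_left _ h1
        _ = _ := by rw [mul_pow, mul_assoc]
    refine (Nat.pow_lt_pow_iff_left hj).1 ?_
    calc (n ^ 2) ^ j = (n ^ j) ^ 2 := by rw [← pow_mul, ← pow_mul, mul_comm]
      _ ≤ ((2 * j) ^ j * n.choose j) ^ 2 := Nat.pow_le_pow_left h2 2
      _ < ((2 * j) ^ j * 2 ^ j.choose 2) ^ 2 := Nat.pow_lt_pow_left
          (Nat.mul_lt_mul_of_pos_left h (by positivity)) two_ne_zero
      _ = _ := by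
          rw [mul_pow, two_pow_choose_two_sq, mul_pow _ (4 * j ^ 2), mul_comm, pow_right_comm _ j 2,
            mul_pow 2 j 2, show 2 ^ 2 = 4 from rfl]

theorem fExp_succ_mul_le (n j : ℕ) : fExp n (j + 1) * (2 ^ j * (j + 1)) ≤ fExp n j * n := by
  have h1 : (n.choose (j + 1) : ℝ) * (j + 1) ≤ n.choose j * n := by
    exact_mod_cast (Nat.choose_succ_right_eq n j).trans_le
      (Nat.mul_le_mul_left _ (Nat.sub_le n j))
  have h2 : (j + 1).choose 2 = j + j.choose 2 := by
    rw [Nat.choose_succ_succ' j 1, Nat.choose_one_right]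
  rw [fExp, fExp, h2, pow_add, div_mul_eq_mul_div, div_mul_eq_mul_div,
    div_le_div_iff₀ (by positivity) (by positivity)]
  have h3 : (0 : ℝ) ≤ 2 ^ j * 2 ^ j.choose 2 := by positivity
  nlinarith [mul_le_mul_of_nonneg_right h1 h3]

theorem fExp_nonneg (n j : ℕ) : 0 ≤ fExp n j := by unfold fExp; positivity

theorem fExp_kZero_lt_one (n : ℕ) : fExp n (kZero n) < 1 :=
  Nat.sInf_mem (s := {k | fExp n k < 1})
    ⟨n + 1, by simp [fExp]⟩

theorem one_le_fExp_of_lt_kZero {n j : ℕ} (h : j < kZero n) : 1 ≤ fExp n j :=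
  not_lt.1 (Nat.notMem_of_lt_sInf h)

theorem fExp_add_three_mul_le (n k : ℕ) :
    fExp n (k + 3) * (2 ^ k * (k + 1)) ^ 3 ≤ fExp n k * (n : ℝ) ^ 3 := by
  set y : ℝ := 2 ^ k * (k + 1) with hy
  have hy0 : 0 ≤ y := by positivity
  have h : ∀ i, fExp n (k + i + 1) * y ≤ fExp n (k + i) * n := fun i => by
    refine le_trans (mul_le_mul_of_nonneg_left ?_ (fExp_nonneg _ _)) (fExp_succ_mul_le n (k + i))
    rw [hy]
    push_cast
    gcongr <;> norm_num
  have h0 := mul_le_mul_of_nonneg_right (h 2) (sq_nonneg y)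
  have h1 := mul_le_mul_of_nonneg_right (h 1) (by positivity : 0 ≤ n * y)
  have h2 := mul_le_mul_of_nonneg_right (h 0) (by positivity : 0 ≤ (n : ℝ) ^ 2)
  simp only [add_assoc, Nat.reduceAdd, add_zero] at h0 h1 h2
  linarith

open Filter in
theorem eventually_poly_le_two_pow :
    ∀ᶠ k : ℕ in atTop, ((32 * ((k : ℝ) + 4) ^ 2) ^ 3) ^ 2 ≤ 2 ^ k := by
  have h := tendsto_pow_const_div_const_pow_of_one_lt 12 (one_lt_two (α := ℝ))
  have h' := h.eventually
    (ge_mem_nhds (show (0 : ℝ) < 1 / (32 ^ 6 * 5 ^ 12) by positivity))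
  filter_upwards [h', eventually_ge_atTop 1] with k hk hk1
  have hk1' : (1 : ℝ) ≤ k := by exact_mod_cast hk1
  rw [div_le_div_iff₀ (by positivity) (by positivity)] at hk
  calc ((32 * ((k : ℝ) + 4) ^ 2) ^ 3) ^ 2 ≤ ((32 * (5 * (k : ℝ)) ^ 2) ^ 3) ^ 2 := by
        gcongr; linarith
    _ = (k : ℝ) ^ 12 * (32 ^ 6 * 5 ^ 12) := by ring
    _ ≤ _ := by linarith

/-- For large `n`, `kZero n - 4` is large and `fExp n (kZero n - 4)` is at least `n ^ 2`. -/
theorem exists_le_kZero_sub_and_sq_le_fExp (K : ℕ) :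
    ∃ N : ℕ, ∀ n, N ≤ n → K ≤ kZero n - 4 ∧ (n : ℝ) ^ 2 ≤ fExp n (kZero n - 4) := by
  obtain ⟨K₁, hK₁⟩ := Filter.eventually_atTop.1 eventually_poly_le_two_pow
  set L := max (max K K₁) 1 with hL
  refine ⟨2 ^ (L + 4) * (4 * (L + 4) ^ 2) + 1, fun n hn => ?_⟩
  have hlt := sq_lt_of_fExp_lt_one (fExp_kZero_lt_one n)
  have hk0 : L + 4 ≤ kZero n := by
    by_contra! h
    have h1 : 2 ^ (kZero n - 1) * (4 * kZero n ^ 2) ≤ 2 ^ (L + 4) * (4 * (L + 4) ^ 2) := by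
      gcongr
      · norm_num
      · omega
    nlinarith
  obtain ⟨k, hk⟩ : ∃ k, kZero n = k + 4 := ⟨kZero n - 4, by omega⟩
  rw [hk] at hlt hk0 ⊢
  simp only [Nat.add_sub_cancel]
  have hKk : K ≤ k := by omega
  refine ⟨hKk, ?_⟩
  have h1 : 1 ≤ fExp n (k + 3) := one_le_fExp_of_lt_kZero (by omega)
  have h2 := two_pow_le_sq_of_one_le_fExp (by omega) h1
  have h3 := fExp_add_three_mul_le n k
  have h4 := hK₁ k (by omega)
  have hn0 : (0 : ℝ) < n := by
    have : 0 < n := by omega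
    exact_mod_cast this
  set c : ℝ := 32 * ((k : ℝ) + 4) ^ 2 with hc
  set y : ℝ := 2 ^ k * ((k : ℝ) + 1) with hy
  have hc0 : 0 < c := by positivity
  have h5 : c ^ 3 ≤ n := by
    refine le_of_sq_le_sq ?_ hn0.le
    refine h4.trans (le_trans ?_ (by exact_mod_cast h2 : (2 : ℝ) ^ (k + 3 - 1) ≤ (n : ℝ) ^ 2))
    exact pow_le_pow_right₀ one_le_two (by omega)
  have h6 : (n : ℝ) ^ 2 ≤ c * y := by
    have h7 : (n : ℝ) ^ 2 ≤ 2 ^ (k + 3) * (4 * (k + 4) ^ 2) := by exact_mod_cast hlt.le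
    refine h7.trans ?_
    have : (2 : ℝ) ^ (k + 3) * (4 * (k + 4) ^ 2) = c * 2 ^ k := by rw [hc, pow_add]; ring
    rw [this, hy]
    refine mul_le_mul_of_nonneg_left (le_mul_of_one_le_right (by positivity) ?_) hc0.le
    simp
  have h7 : ((n : ℝ) ^ 2) ^ 3 ≤ (c * y) ^ 3 := pow_le_pow_left₀ (by positivity) h6 3
  have h8 : y ^ 3 ≤ fExp n k * (n : ℝ) ^ 3 :=
    (le_mul_of_one_le_left (by positivity) h1).trans h3
  have h9 := mul_le_mul_of_nonneg_left h8 (by positivity : 0 ≤ c ^ 3)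
  have h10 : (n : ℝ) ^ 3 ≤ fExp n k * c ^ 3 := by
    refine le_of_mul_le_mul_right ?_ (by positivity : 0 < (n : ℝ) ^ 3)
    linarith
  refine le_of_mul_le_mul_right (le_trans ?_ h10) (by positivity : 0 < c ^ 3)
  have := mul_le_mul_of_nonneg_left h5 (by positivity : 0 ≤ (n : ℝ) ^ 2)
  linarith

theorem log_mul_exp_le_sqrt {x : ℝ} (hx : Real.exp 24 ≤ x) :
    2 * (Real.log x / 8 * Real.exp (2 * (Real.log x / 8) + 2)) ≤ √x := by
  have hx0 : 0 < x := (Real.exp_pos _).trans_le hx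
  have hL : 3 ≤ Real.log x / 8 := by
    have := (Real.le_log_iff_exp_le hx0).2 hx
    linarith
  have hs : √x = Real.exp (Real.log x / 8) ^ 4 := by
    rw [Real.sqrt_eq_rpow, Real.rpow_def_of_pos hx0, ← Real.exp_nat_mul]
    congr 1
    push_cast
    ring
  rw [hs]
  set L := Real.log x / 8
  have h1 : L ≤ Real.exp L := by linarith [Real.add_one_le_exp L]
  have h2 : 2 * Real.exp 2 ≤ Real.exp L := by
    calc 2 * Real.exp 2 ≤ Real.exp 1 * Real.exp 2 := by
          gcongr; linarith [Real.add_one_le_exp 1]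
      _ = Real.exp 3 := by rw [← Real.exp_add]; norm_num
      _ ≤ _ := Real.exp_le_exp.2 hL
  have h3 : Real.exp (2 * L + 2) = Real.exp L ^ 2 * Real.exp 2 := by
    rw [Real.exp_add, ← Real.exp_nat_mul]; norm_num
  rw [h3]
  calc 2 * (L * (Real.exp L ^ 2 * Real.exp 2))
      = L * (Real.exp L ^ 2 * (2 * Real.exp 2)) := by ring
    _ ≤ Real.exp L * (Real.exp L ^ 2 * Real.exp L) := by gcongr
    _ = _ := by ring

/-- There is `c > 0` such that for all large `n`, with `k = k₀(n) - 4` and `M = f_n(k)`: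
every graph `Γ` with `M/2 ≤ |V(Γ)| ≤ 2M` vertices, fewer than `k⁴M²/n²` edges, and
fewer than `2k⁶M³/n⁴` triangles has an independent set of size at least
`c·n²·(log k)/k⁴`. -/
theorem stmt9 :
    ∃ c : ℝ, 0 < c ∧ ∃ N : ℕ, ∀ n, N ≤ n →
      ∀ (V : Type*) (_ : Fintype V) (_ : DecidableEq V) (Γ : SimpleGraph V) (_ : DecidableRel Γ.Adj),
        fExp n (kZero n - 4) / 2 ≤ (Fintype.card V : ℝ) →
        (Fintype.card V : ℝ) ≤ 2 * fExp n (kZero n - 4) →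
        (Γ.edgeFinset.card : ℝ) <
          ((kZero n - 4 : ℕ) : ℝ) ^ 4 * fExp n (kZero n - 4) ^ 2 / (n : ℝ) ^ 2 →
        ((Γ.cliqueFinset 3).card : ℝ) <
          2 * ((kZero n - 4 : ℕ) : ℝ) ^ 6 * fExp n (kZero n - 4) ^ 3 / (n : ℝ) ^ 4 →
        ∃ S : Finset V, (∀ a ∈ S, ∀ b ∈ S, a ≠ b → ¬ Γ.Adj a b) ∧
          c * (n : ℝ) ^ 2 * Real.log ((kZero n - 4 : ℕ) : ℝ) / ((kZero n - 4 : ℕ) : ℝ) ^ 4 ≤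
            (S.card : ℝ) := by
  obtain ⟨N, hN⟩ := exists_le_kZero_sub_and_sq_le_fExp ⌈Real.exp 24⌉₊
  refine ⟨1 / 1024, by norm_num, N + 1, fun n hn V _ _ Γ _ => ?_⟩
  obtain ⟨hk, hM⟩ := hN n (by omega)
  generalize kZero n - 4 = k' at *
  generalize fExp n k' = M at *
  intro hV _ hE hT
  set k : ℝ := (k' : ℝ)
  have hk' : Real.exp 24 ≤ k := (Nat.le_ceil _).trans (Nat.cast_le.2 hk)
  have hk24 : 25 ≤ k := by linarith [Real.add_one_le_exp 24]
  have hk0 : 0 < k := by linarith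
  have hn0 : (0 : ℝ) < n := by
    have : 0 < n := by omega
    exact_mod_cast this
  have hM0 : 0 < M := lt_of_lt_of_le (by positivity) hM
  set A : ℝ := 16 * k ^ 4 * M / n ^ 2 with hA
  set t : ℝ := 432 * k ^ 6 * M ^ 2 / n ^ 4 with ht
  have hA0 : 0 < A := by positivity
  have ht0 : 0 < t := by positivity
  have hkA : 2 * k ≤ A := by
    rw [hA, le_div_iff₀ (by positivity)]
    have h1 : k * 1 ≤ k * k ^ 3 :=
      mul_le_mul_of_nonneg_left (one_le_pow₀ (by linarith)) hk0.le
    calc 2 * k * (n : ℝ) ^ 2 ≤ 16 * (k * k ^ 3) * M := by gcongr <;> linarith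
      _ = _ := by ring
  obtain ⟨U, hU, hUd, hUt⟩ := Γ.exists_large_locally_sparse hA0 ht0
    (by
      have := mul_le_mul_of_nonneg_left hV hA0.le
      refine le_trans ?_ this
      refine (mul_le_mul_of_nonneg_left hE.le (by norm_num)).trans (le_of_eq ?_)
      rw [hA]; ring)
    (by
      have := mul_le_mul_of_nonneg_left hV ht0.le
      refine le_trans ?_ this
      refine (mul_le_mul_of_nonneg_left hT.le (by norm_num)).trans (le_of_eq ?_)
      rw [ht]; ring)
  have hs0 : 0 < √k := Real.sqrt_pos.2 hk0
  have hsk : √k ≤ k := by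
    rw [Real.sqrt_le_left hk0.le]; nlinarith
  have hlog : Real.log k ≤ k := by linarith [Real.log_le_sub_one_of_pos hk0]
  have hlog0 : 0 ≤ Real.log k := Real.log_nonneg (by linarith)
  have hlt : (√k / A) ^ 2 * t ≤ 1 := by
    have : (√k / A) ^ 2 * t = 27 / 16 / k := by
      rw [div_pow, Real.sq_sqrt hk0.le, hA, ht]
      field_simp
      norm_num
    rw [this, div_le_one hk0]
    linarith
  obtain ⟨I, hI, hcard⟩ := Γ.exists_mem_indepSubsets_card (U := U) (l := √k / A) (A := A)
    (Q := Real.log k / 8) (by positivity) (by rw [div_le_iff₀ hA0]; linarith) (by positivity)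
    (by linarith) hUd
    (fun v hv => (mul_le_mul_of_nonneg_left (hUt v hv) (sq_nonneg _)).trans hlt)
    (by rw [div_mul_cancel₀ _ hA0.ne']; exact log_mul_exp_le_sqrt hk')
  refine ⟨I, fun a ha b hb _ => (SimpleGraph.mem_indepSubsets.1 hI).2 a ha b hb, ?_⟩
  have h1 : M / 4 * (Real.log k / 8) ≤ 2 * A * (I.card : ℝ) :=
    (mul_le_mul_of_nonneg_right (by linarith) (by positivity)).trans hcard
  rw [div_le_iff₀ (by positivity)]
  refine le_of_mul_le_mul_left ?_ hM0
  have h2 : 2 * A * (I.card : ℝ) * n ^ 2 = 32 * k ^ 4 * M * (I.card : ℝ) := by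
    rw [hA]; field_simp; ring
  have h3 := mul_le_mul_of_nonneg_right h1 (by positivity : 0 ≤ (n : ℝ) ^ 2)
  rw [h2] at h3
  linarith
end

section
/- For all positive integers n, k, t with k ≤ n, the probability that the random graph G_{n,1/2} contains a packing of k-cliques of size at least t satisfies P( ν_k(G_{n,1/2}) ≥ t ) ≤ ζ(n,k,t) · ( C(n,k)·2^{−C(k,2)} )^t. -/
/-- `P` is a packing of `k`-cliques in the graph `G` on `{1,…,n}`. -/
def IsCliquePacking (n k : ℕ) (G : SimpleGraph (Fin n)) (P : Finset (Finset (Fin n))) : Prop :=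
  (∀ A ∈ P, A.card = k ∧ G.IsClique (A : Set (Fin n))) ∧
    ∀ A ∈ P, ∀ B ∈ P, A ≠ B → (A ∩ B).card ≤ 1

/-- `nuPack n k G` is the maximum size of a packing of `k`-cliques in `G`. -/
noncomputable def nuPack (n k : ℕ) (G : SimpleGraph (Fin n)) : ℕ :=
  sSup {m | ∃ P, IsCliquePacking n k G P ∧ P.card = m}

/-- Probability of an event under the uniform random graph `G_{n,1/2}`. -/
noncomputable def prGraph (n : ℕ) (E : SimpleGraph (Fin n) → Prop) : ℝ :=
  (Nat.card {G : SimpleGraph (Fin n) // E G} : ℝ) / (Nat.card (SimpleGraph (Fin n)) : ℝ)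

/-- The pairs of distinct elements of `A`, as potential edges of a graph. -/
def cliqueEdges {V : Type*} [DecidableEq V] (A : Finset V) : Finset (Sym2 V) :=
  A.offDiag.image (Function.uncurry Sym2.mk)

lemma card_cliqueEdges {V : Type*} [DecidableEq V] (A : Finset V) :
    (cliqueEdges A).card = A.card.choose 2 :=
  Sym2.card_image_offDiag A

lemma cliqueEdges_subset_edgeSet {V : Type*} [DecidableEq V] {G : SimpleGraph V} {A : Finset V}
    (h : G.IsClique (A : Set V)) : (cliqueEdges A : Set (Sym2 V)) ⊆ G.edgeSet := by
  intro e he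
  obtain ⟨⟨a, b⟩, hab, rfl⟩ := Finset.mem_image.mp (Finset.mem_coe.mp he)
  obtain ⟨ha, hb, hne⟩ := Finset.mem_offDiag.mp hab
  exact h ha hb hne

lemma disjoint_cliqueEdges {V : Type*} [DecidableEq V] {A B : Finset V}
    (h : (A ∩ B).card ≤ 1) : Disjoint (cliqueEdges A) (cliqueEdges B) := by
  rw [Finset.disjoint_left]
  intro e hA hB
  obtain ⟨⟨a, b⟩, hab, rfl⟩ := Finset.mem_image.mp hA
  obtain ⟨⟨c, d⟩, hcd, hEq⟩ := Finset.mem_image.mp hB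
  simp only [Finset.mem_offDiag] at hab hcd
  have hB' : a ∈ B ∧ b ∈ B := by
    rcases Sym2.eq_iff.mp hEq with ⟨rfl, rfl⟩ | ⟨rfl, rfl⟩
    · exact ⟨hcd.1, hcd.2.1⟩
    · exact ⟨hcd.2.1, hcd.1⟩
  exact hab.2.2 (Finset.card_le_one.mp h a (Finset.mem_inter.mpr ⟨hab.1, hB'.1⟩)
    b (Finset.mem_inter.mpr ⟨hab.2.1, hB'.2⟩))

/-- Deleting an arbitrary subset of `F` from a graph containing `F` loses no information. -/
lemma card_graphs_containing_mul_le {V : Type*} [Finite V] (F : Finset (Sym2 V)) :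
    Nat.card {G : SimpleGraph V // (F : Set (Sym2 V)) ⊆ G.edgeSet} * 2 ^ F.card ≤
      Nat.card (SimpleGraph V) := by
  rw [← Finset.card_powerset, ← Nat.card_eq_finsetCard, ← Nat.card_prod]
  refine Nat.card_le_card_of_injective
    (fun p => p.1.1.deleteEdges (p.2.1 : Set (Sym2 V))) ?_
  rintro ⟨⟨G, hG⟩, ⟨S, hS⟩⟩ ⟨⟨H, hH⟩, ⟨T, hT⟩⟩ h
  rw [Finset.mem_powerset] at hS hT
  have key : ∀ e, (e ∈ G.edgeSet ∧ e ∉ S) ↔ (e ∈ H.edgeSet ∧ e ∉ T) := by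
    intro e
    have := congrArg (fun K : SimpleGraph V => e ∈ K.edgeSet) h
    simpa [SimpleGraph.edgeSet_deleteEdges] using this
  have hST : S = T := by
    ext e
    have := key e
    have h1 := @hG e
    have h2 := @hH e
    have h3 := @hS e
    have h4 := @hT e
    simp only [Finset.mem_coe] at h1 h2
    tauto
  subst hST
  have hGH : G = H := by
    rw [← SimpleGraph.edgeSet_inj]
    ext e
    have := key e
    have h1 := @hG e
    have h2 := @hH e
    have h3 := @hS e
    simp only [Finset.mem_coe] at h1 h2
    tauto
  subst hGH
  rfl

lemma exists_isCliquePacking_card_eq_nuPack (n k : ℕ) (G : SimpleGraph (Fin n)) :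
    ∃ P, IsCliquePacking n k G P ∧ P.card = nuPack n k G := by
  refine Nat.sSup_mem (s := {m | ∃ P, IsCliquePacking n k G P ∧ P.card = m})
    ⟨0, ∅, by simp [IsCliquePacking]⟩ ⟨Fintype.card (Finset (Fin n)), ?_⟩
  rintro m ⟨P, -, rfl⟩
  exact Finset.card_le_univ P

/-- The ordered packings counted by `zeta`. -/
abbrev PackingTuple (n k t : ℕ) : Type :=
  {A : Fin t → Finset (Fin n) //
    (∀ i, (A i).card = k) ∧ ∀ i j, i ≠ j → ((A i) ∩ (A j)).card ≤ 1}

/-- All edges required by the members of an ordered packing. -/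
def PackingTuple.edges {n k t : ℕ} (A : PackingTuple n k t) : Finset (Sym2 (Fin n)) :=
  Finset.univ.biUnion fun i => cliqueEdges (A.1 i)

lemma PackingTuple.card_edges {n k t : ℕ} (A : PackingTuple n k t) :
    A.edges.card = t * k.choose 2 := by
  rw [PackingTuple.edges, Finset.card_biUnion fun i _ j _ hij =>
    disjoint_cliqueEdges (A.2.2 i j hij)]
  simp [card_cliqueEdges, A.2.1]

lemma exists_packingTuple_of_le_nuPack {n k t : ℕ} {G : SimpleGraph (Fin n)}
    (h : t ≤ nuPack n k G) :
    ∃ A : PackingTuple n k t, (A.edges : Set (Sym2 (Fin n))) ⊆ G.edgeSet := by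
  obtain ⟨P, hP, hcard⟩ := exists_isCliquePacking_card_eq_nuPack n k G
  have hle : t ≤ P.card := hcard ▸ h
  let f : Fin t → P := fun i => P.equivFin.symm (Fin.castLE hle i)
  have hf : Function.Injective f :=
    P.equivFin.symm.injective.comp (Fin.castLE_injective hle)
  refine ⟨⟨fun i => (f i).1, fun i => (hP.1 _ (f i).2).1, fun i j hij =>
    hP.2 _ (f i).2 _ (f j).2 fun hEq => hij (hf (Subtype.ext hEq))⟩, ?_⟩
  simp only [PackingTuple.edges, Finset.coe_biUnion, Set.iUnion_subset_iff]
  exact fun i _ => cliqueEdges_subset_edgeSet (hP.1 _ (f i).2).2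

lemma card_le_nuPack_mul_le (n k t : ℕ) :
    Nat.card {G : SimpleGraph (Fin n) // t ≤ nuPack n k G} * 2 ^ (t * k.choose 2) ≤
      Nat.card (PackingTuple n k t) * Nat.card (SimpleGraph (Fin n)) := by
  have hinj : Nat.card {G : SimpleGraph (Fin n) // t ≤ nuPack n k G} ≤
      Nat.card (Σ A : PackingTuple n k t,
        {G : SimpleGraph (Fin n) // (A.edges : Set (Sym2 (Fin n))) ⊆ G.edgeSet}) := by
    choose A hA using fun G : {G : SimpleGraph (Fin n) // t ≤ nuPack n k G} =>
      exists_packingTuple_of_le_nuPack G.2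
    refine Nat.card_le_card_of_injective (fun G => ⟨A G, G.1, hA G⟩) ?_
    exact fun G H h => Subtype.ext
      (congrArg (fun x : (Σ A : PackingTuple n k t, {G : SimpleGraph (Fin n) //
        (A.edges : Set (Sym2 (Fin n))) ⊆ G.edgeSet}) => x.2.1) h)
  refine (Nat.mul_le_mul_right _ hinj).trans ?_
  rw [Nat.card_sigma, Finset.sum_mul, Nat.card_eq_fintype_card (α := PackingTuple n k t),
    ← Finset.card_univ, ← smul_eq_mul (Finset.card _)]
  refine Finset.sum_le_card_nsmul _ _ _ fun A _ => ?_
  rw [← A.card_edges]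
  exact card_graphs_containing_mul_le A.edges

/-- For all positive integers `n, k, t` with `k ≤ n`,
`P(ν_k(G_{n,1/2}) ≥ t) ≤ ζ(n,k,t)·(C(n,k)·2^{-C(k,2)})^t`. -/
theorem stmt12 (n k t : ℕ) (hn : 0 < n) (hk : 0 < k) (hkn : k ≤ n) (ht : 0 < t) :
    prGraph n (fun G => t ≤ nuPack n k G) ≤
      zeta n k t * ((n.choose k : ℝ) / 2 ^ (k.choose 2)) ^ t := by
  have hC : (0 : ℝ) < n.choose k := by exact_mod_cast Nat.choose_pos hkn
  have hN : (0 : ℝ) < Nat.card (SimpleGraph (Fin n)) := by exact_mod_cast Nat.card_pos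
  have hcount : (Nat.card {G : SimpleGraph (Fin n) // t ≤ nuPack n k G} : ℝ) *
      (2 ^ k.choose 2) ^ t ≤
      Nat.card (PackingTuple n k t) * Nat.card (SimpleGraph (Fin n)) := by
    rw [← pow_mul, mul_comm _ t]
    exact_mod_cast card_le_nuPack_mul_le n k t
  have hzeta : zeta n k t * ((n.choose k : ℝ) / 2 ^ (k.choose 2)) ^ t =
      Nat.card (PackingTuple n k t) / (2 ^ k.choose 2) ^ t := by
    rw [zeta, div_pow, div_mul_div_cancel₀ (pow_pos hC t).ne']
  rw [hzeta, prGraph, div_le_div_iff₀ hN (by positivity)]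
  exact hcount
end
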